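/- arXiv:2502.20987 — 9 statements merged into one kernel-verified Lean document; each statement's English description precedes it below -/
import Mathlib

section
/- Let Δ₁ and Δ₂ be simplicial complexes on the same finite vertex set V with Δ₁ ⊆ Δ₂, and let q ≥ 1 be an integer. If σ_qΔ₁ = σ_qΔ₂, then σ_{q+1}Δ₁ = σ_{q+1}Δ₂. -/
open SimpleGraph Finset

/-- A simplicial complex on the vertex type `V`: closed under subsets and
containing every singleton. -/
def IsComplex {V : Type*} (Δ : Set (Finset V)) : Prop :=
  (∀ F ∈ Δ, ∀ G : Finset V, G ⊆ F → G ∈ Δ) ∧ (∀ v : V, ({v} : Finset V) ∈ Δ)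

/-- The `q`-secant complex `σ_q Δ`: its faces are unions of `q` faces of `Δ`. -/
def secant {V : Type*} [DecidableEq V] (q : ℕ) (Δ : Set (Finset V)) : Set (Finset V) :=
  {F | ∃ f : Fin q → Finset V, (∀ i, f i ∈ Δ) ∧ F = Finset.univ.sup f}

/-- Clique complex of a graph. -/
def cliqueComplex {V : Type*} (G : SimpleGraph V) : Set (Finset V) :=
  {F | G.IsClique (F : Set V)}

/-- `S` is a union of `q` cliques of `G`. -/
def CliqueCoverable {V : Type*} (G : SimpleGraph V) (q : ℕ) (S : Set V) : Prop :=
  ∃ f : Fin q → Set V, (∀ i, G.IsClique (f i)) ∧ S = ⋃ i, f i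

/-- Membership in the family `𝓕_{q,1}`: `H` is not the edgeless graph on `q+1`
vertices, its vertex set is not a union of `q` cliques, but every proper subset is. -/
def MemF1 {V : Type*} [Fintype V] (q : ℕ) (H : SimpleGraph V) : Prop :=
  ¬(Fintype.card V = q + 1 ∧ H = ⊥) ∧
  ¬CliqueCoverable H q Set.univ ∧
  ∀ S : Set V, S ≠ Set.univ → CliqueCoverable H q S

/-- `𝓕_{q,1}`-freeness: no induced subgraph belongs to `𝓕_{q,1}`. -/
def F1Free {V : Type*} [Fintype V] [DecidableEq V] (q : ℕ) (G : SimpleGraph V) : Prop :=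
  ∀ S : Finset V, ¬MemF1 q (G.induce (S : Set V))

/-- Elementary bipartite graph: a bipartite graph such that removing any vertex from
each side leaves a graph with a perfect matching. -/
def ElemBipartite {V : Type*} (H : SimpleGraph V) : Prop :=
  ∃ U W : Set V, Disjoint U W ∧ U ∪ W = Set.univ ∧
    (∀ a b, H.Adj a b → (a ∈ U ∧ b ∈ W) ∨ (a ∈ W ∧ b ∈ U)) ∧
    ∀ u ∈ U, ∀ w ∈ W, ∃ M : H.Subgraph, M.verts = Set.univ \ {u, w} ∧ M.IsMatching

/-- Membership in the family `𝓕_{q,2}`: a disjoint union of an elementary bipartite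
graph on `2j+2` vertices (1 ≤ j ≤ q) with `q - j` isolated vertices. -/
def MemF2 {V : Type*} [Fintype V] [DecidableEq V] (q : ℕ) (G : SimpleGraph V) : Prop :=
  ∃ j : ℕ, 1 ≤ j ∧ j ≤ q ∧ ∃ S : Finset V,
    S.card = 2 * j + 2 ∧ Fintype.card V = (2 * j + 2) + (q - j) ∧
    (∀ a b, G.Adj a b → a ∈ S ∧ b ∈ S) ∧
    ElemBipartite (G.induce (S : Set V))

/-- `𝓕_{q,2}`-freeness. -/
def F2Free {V : Type*} [Fintype V] [DecidableEq V] (q : ℕ) (G : SimpleGraph V) : Prop :=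
  ∀ S : Finset V, ¬MemF2 q (G.induce (S : Set V))

/-- `G` has no induced cycle `C_n`. -/
def CycleFree {V : Type*} [Fintype V] [DecidableEq V] (G : SimpleGraph V) (n : ℕ) : Prop :=
  ∀ S : Finset V, IsEmpty (G.induce (S : Set V) ≃g cycleGraph n)

/-- `q`-secant chordality: `𝓕_{q,1}`-free, `𝓕_{q,2}`-free and `C_{2q+p}`-free for all `p ≥ 3`. -/
def SecantChordal {V : Type*} [Fintype V] [DecidableEq V] (q : ℕ) (G : SimpleGraph V) : Prop :=
  F1Free q G ∧ F2Free q G ∧ ∀ p : ℕ, 3 ≤ p → CycleFree G (2 * q + p)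

/-- Edge contraction `G/e` where `e = {u, v}`: the vertex `u` is removed and `v` plays
the role of the new identified vertex `z`, which is adjacent to every vertex adjacent
in `G` to `u` or to `v`; other adjacencies are unchanged. -/
def contractEdge {V : Type*} (G : SimpleGraph V) (u v : V) :
    SimpleGraph {a : V // a ≠ u} :=
  SimpleGraph.fromRel (fun a b =>
    G.Adj a.1 b.1 ∨ (a.1 = v ∧ G.Adj u b.1) ∨ (b.1 = v ∧ G.Adj a.1 u))

/-- Independent set: a set of pairwise nonadjacent vertices. -/
def IsIndepSet {V : Type*} (G : SimpleGraph V) (S : Set V) : Prop :=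
  ∀ a ∈ S, ∀ b ∈ S, a ≠ b → ¬G.Adj a b

theorem mem_secant_succ_iff {V : Type*} [DecidableEq V] (n : ℕ) (Δ : Set (Finset V))
    (F : Finset V) :
    F ∈ secant (n + 1) Δ ↔ ∃ A ∈ Δ, ∃ B ∈ secant n Δ, F = A ∪ B := by
  constructor
  · rintro ⟨f, hf, rfl⟩
    refine ⟨f 0, hf 0, _, ⟨fun i => f i.succ, fun i => hf _, rfl⟩, ?_⟩
    ext x
    simp [Finset.mem_sup, Fin.exists_fin_succ]
  · rintro ⟨A, hA, B, ⟨f, hf, rfl⟩, rfl⟩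
    refine ⟨Fin.cons A f, fun i => ?_, ?_⟩
    · refine Fin.cases ?_ (fun j => ?_) i
      · simpa using hA
      · simpa using hf j
    · ext x
      simp [Finset.mem_sup, Fin.exists_fin_succ]

theorem secant_mono' {V : Type*} [DecidableEq V] (n : ℕ) {Δ₁ Δ₂ : Set (Finset V)}
    (hsub : Δ₁ ⊆ Δ₂) : secant n Δ₁ ⊆ secant n Δ₂ := by
  rintro F ⟨f, hf, rfl⟩
  exact ⟨f, fun i => hsub (hf i), rfl⟩

/-- If `σ_q Δ₁ = σ_q Δ₂` for nested complexes on the same finite vertex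
set, then `σ_{q+1} Δ₁ = σ_{q+1} Δ₂`. -/
theorem secant_succ_eq_of_secant_eq {V : Type*} [Fintype V] [DecidableEq V]
    (Δ₁ Δ₂ : Set (Finset V)) (h₁ : IsComplex Δ₁) (h₂ : IsComplex Δ₂)
    (hsub : Δ₁ ⊆ Δ₂) (q : ℕ) (hq : 1 ≤ q)
    (h : secant q Δ₁ = secant q Δ₂) :
    secant (q + 1) Δ₁ = secant (q + 1) Δ₂ := by
  apply Set.Subset.antisymm (secant_mono' _ hsub)
  intro F hF
  obtain ⟨n, rfl⟩ : ∃ n, q = n + 1 := ⟨q - 1, by omega⟩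
  obtain ⟨A, hA, B, hB, rfl⟩ := (mem_secant_succ_iff _ _ _).1 hF
  rw [← h] at hB
  obtain ⟨C, hC, D, hD, rfl⟩ := (mem_secant_succ_iff _ _ _).1 hB
  have hAD : A ∪ D ∈ secant (n + 1) Δ₂ :=
    (mem_secant_succ_iff _ _ _).2 ⟨A, hA, D, secant_mono' _ hsub hD, rfl⟩
  rw [← h] at hAD
  exact (mem_secant_succ_iff _ _ _).2 ⟨C, hC, _, hAD, Finset.union_left_comm A C D⟩
end

section
/- Let q ≥ 1, let G be a finite simple graph belonging to F_{q,2}, and let e be an edge of G such that no induced subgraph of G isomorphic to the 4-cycle C₄ contains both endpoints of e. Then the edge contraction G/e belongs to F_{q,1}. -/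
open SimpleGraph Finset

theorem aux_cover {X Y : Type*} [DecidableEq Y] (H : SimpleGraph X) (q : ℕ) (T : Set X)
    (f : X → Y) (Q : Finset Y) (hQ : Q.card ≤ q) (hf : ∀ a ∈ T, f a ∈ Q)
    (h : ∀ a ∈ T, ∀ b ∈ T, a ≠ b → f a = f b → H.Adj a b) : CliqueCoverable H q T := by
  classical
  let e := Q.equivFin
  refine ⟨fun i => {a | a ∈ T ∧ ∃ h : f a ∈ Q, (e ⟨f a, h⟩ : ℕ) = i}, ?_, ?_⟩
  · rintro i a ⟨ha, h1, h2⟩ b ⟨hb, h3, h4⟩ hab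
    apply h a ha b hb hab
    have : e ⟨f a, h1⟩ = e ⟨f b, h3⟩ := Fin.ext (h2.trans h4.symm)
    simpa using e.injective this
  · ext a
    simp only [Set.mem_iUnion, Set.mem_ofPred_eq]
    constructor
    · intro ha
      exact ⟨⟨e ⟨f a, hf a ha⟩, lt_of_lt_of_le (Fin.is_lt _) hQ⟩, ha, hf a ha, rfl⟩
    · rintro ⟨i, ha, _⟩
      exact ha

theorem aux_partner {V : Type*} [DecidableEq V] (G : SimpleGraph V) (S : Finset V)
    (a b : V) (ha : a ∈ S) (hb : b ∈ S) (M : (G.induce (S : Set V)).Subgraph)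
    (hv : M.verts = Set.univ \ {⟨a, ha⟩, ⟨b, hb⟩}) (hM : M.IsMatching) :
    ∃ p : V → V, ∀ x ∈ S, x ≠ a → x ≠ b →
      p x ∈ S ∧ p x ≠ a ∧ p x ≠ b ∧ G.Adj x (p x) ∧ p (p x) = x := by
  classical
  have key : ∀ x : V, ∃ y : V, ∀ hx : x ∈ S, x ≠ a → x ≠ b →
      ∃ hy : y ∈ S, M.Adj ⟨x, hx⟩ ⟨y, hy⟩ := by
    intro x
    by_cases hx : x ∈ S ∧ x ≠ a ∧ x ≠ b
    · have : (⟨x, hx.1⟩ : (S : Set V)) ∈ M.verts := by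
        rw [hv]; simp [hx.2.1, hx.2.2]
      obtain ⟨y, hy, _⟩ := hM this
      exact ⟨y.1, fun _ _ _ => ⟨y.2, hy⟩⟩
    · exact ⟨x, fun h1 h2 h3 => absurd ⟨h1, h2, h3⟩ hx⟩
  choose p hp using key
  refine ⟨p, fun x hx hxa hxb => ?_⟩
  obtain ⟨hy, had⟩ := hp x hx hxa hxb
  have h1 := M.edge_vert had.symm
  rw [hv] at h1
  simp at h1
  obtain ⟨hz, had2⟩ := hp (p x) hy h1.1 h1.2
  have h2 := hM.eq_of_adj_left had2 had.symm
  refine ⟨hy, h1.1, h1.2, M.adj_sub had, ?_⟩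
  simpa using h2

theorem aux_struct {V : Type*} [DecidableEq V] (G : SimpleGraph V) (S : Finset V)
    (hS : ∀ a b, G.Adj a b → a ∈ S ∧ b ∈ S) (hE : ElemBipartite (G.induce (S : Set V)))
    (u v : V) (hadj : G.Adj u v) :
    ∃ A B : Finset V, Disjoint A B ∧ A ∪ B = S ∧ u ∈ A ∧ v ∈ B ∧
      (∀ a b, G.Adj a b → (a ∈ A ∧ b ∈ B) ∨ (a ∈ B ∧ b ∈ A)) ∧
      ∀ a ∈ A, ∀ b ∈ B, ∃ p : V → V, ∀ x ∈ S, x ≠ a → x ≠ b →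
        p x ∈ S ∧ p x ≠ a ∧ p x ≠ b ∧ G.Adj x (p x) ∧ p (p x) = x := by
  classical
  have main : ∀ U W : Set (S : Set V), Disjoint U W → U ∪ W = Set.univ →
    (∀ a b, (G.induce (S : Set V)).Adj a b → (a ∈ U ∧ b ∈ W) ∨ (a ∈ W ∧ b ∈ U)) →
    (∀ u ∈ U, ∀ w ∈ W, ∃ M : (G.induce (S : Set V)).Subgraph,
      M.verts = Set.univ \ {u, w} ∧ M.IsMatching) →
    (⟨u, (hS u v hadj).1⟩ : (S : Set V)) ∈ U → (⟨v, (hS u v hadj).2⟩ : (S : Set V)) ∈ W →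
    ∃ A B : Finset V, Disjoint A B ∧ A ∪ B = S ∧ u ∈ A ∧ v ∈ B ∧
      (∀ a b, G.Adj a b → (a ∈ A ∧ b ∈ B) ∨ (a ∈ B ∧ b ∈ A)) ∧
      ∀ a ∈ A, ∀ b ∈ B, ∃ p : V → V, ∀ x ∈ S, x ≠ a → x ≠ b →
        p x ∈ S ∧ p x ≠ a ∧ p x ≠ b ∧ G.Adj x (p x) ∧ p (p x) = x := by
    intro U W hd hu hb hm hU hW
    have mA : ∀ (T : Set (S : Set V)) (x : V),
        x ∈ S.filter (fun x => ∃ h : x ∈ S, (⟨x, h⟩ : (S : Set V)) ∈ T) ↔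
          ∃ h : x ∈ S, (⟨x, h⟩ : (S : Set V)) ∈ T := by
      intro T x
      rw [Finset.mem_filter]
      exact ⟨fun h => h.2, fun h => ⟨h.1, h⟩⟩
    refine ⟨S.filter (fun x => ∃ h : x ∈ S, (⟨x, h⟩ : (S : Set V)) ∈ U),
      S.filter (fun x => ∃ h : x ∈ S, (⟨x, h⟩ : (S : Set V)) ∈ W), ?_, ?_, ?_, ?_, ?_, ?_⟩
    · rw [Finset.disjoint_left]
      intro x h1 h2
      rw [mA] at h1 h2
      exact Set.disjoint_left.1 hd h1.2 h2.2
    · ext x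
      rw [Finset.mem_union, mA, mA]
      constructor
      · rintro (h | h) <;> exact h.1
      · intro h
        have : (⟨x, h⟩ : (S : Set V)) ∈ U ∪ W := by rw [hu]; trivial
        exact this.imp (fun t => ⟨h, t⟩) (fun t => ⟨h, t⟩)
    · rw [mA]; exact ⟨_, hU⟩
    · rw [mA]; exact ⟨_, hW⟩
    · intro a b hab
      simp only [mA]
      obtain ⟨h1, h2⟩ := hS a b hab
      exact (hb ⟨a, h1⟩ ⟨b, h2⟩ hab).imp (fun t => ⟨⟨h1, t.1⟩, ⟨h2, t.2⟩⟩)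
        (fun t => ⟨⟨h1, t.1⟩, ⟨h2, t.2⟩⟩)
    · intro a ha b hb
      rw [mA] at ha hb
      obtain ⟨M, hv, hM⟩ := hm _ ha.2 _ hb.2
      exact aux_partner G S a b ha.1 hb.1 M hv hM
  obtain ⟨U, W, hd, hu, hb, hm⟩ := hE
  rcases hb ⟨u, (hS u v hadj).1⟩ ⟨v, (hS u v hadj).2⟩ hadj with h | h
  · exact main U W hd hu hb hm h.1 h.2
  · refine main W U hd.symm (by rw [Set.union_comm]; exact hu)
      (fun a b h => (hb a b h).symm) ?_ h.1 h.2
    intro a ha b hb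
    obtain ⟨M, h1, h2⟩ := hm b hb a ha
    exact ⟨M, by rw [h1, Set.pair_comm], h2⟩

theorem aux_C4 {V : Type*} [DecidableEq V] (G : SimpleGraph V) (u v a b : V)
    (huv : G.Adj u v) (hva : G.Adj v a) (hab : G.Adj a b) (hbu : G.Adj b u)
    (hua : ¬ G.Adj u a) (hvb : ¬ G.Adj v b) (h1 : u ≠ a) (h2 : v ≠ b) :
    Nonempty (G.induce ((({u, v, a, b} : Finset V)) : Set V) ≃g cycleGraph 4) := by
  have hm : ∀ i : Fin 4, (![u, v, a, b] i) ∈ ((({u, v, a, b} : Finset V)) : Set V) := by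
    intro i; fin_cases i <;> simp
  let g : Fin 4 → ((({u, v, a, b} : Finset V)) : Set V) := fun i => ⟨![u, v, a, b] i, hm i⟩
  have n1 := huv.ne
  have n2 := hva.ne
  have n3 := hab.ne
  have n4 := hbu.ne
  have hg : Function.Bijective g := by
    constructor
    · intro i j hij
      have : ![u, v, a, b] i = ![u, v, a, b] j := congrArg Subtype.val hij
      fin_cases i <;> fin_cases j <;> simp_all
    · rintro ⟨x, hx⟩
      simp at hx
      rcases hx with rfl | rfl | rfl | rfl
      · exact ⟨0, rfl⟩
      · exact ⟨1, rfl⟩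
      · exact ⟨2, rfl⟩
      · exact ⟨3, rfl⟩
  refine ⟨(RelIso.symm ⟨Equiv.ofBijective g hg, ?_⟩)⟩
  intro i j
  change G.Adj (![u, v, a, b] i) (![u, v, a, b] j) ↔ _
  have s1 := huv.symm
  have s2 := hva.symm
  have s3 := hab.symm
  have s4 := hbu.symm
  have s5 : ¬ G.Adj a u := fun h => hua h.symm
  have s6 : ¬ G.Adj b v := fun h => hvb h.symm
  fin_cases i <;> fin_cases j <;>
    simp [cycleGraph_adj, huv, hva, hab, hbu, hua, hvb, s1, s2, s3, s4, s5, s6] <;> decide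

theorem aux_adj {V : Type*} (G : SimpleGraph V) (u v : V) (x y : {a : V // a ≠ u}) :
    (contractEdge G u v).Adj x y ↔ x ≠ y ∧
      (G.Adj x.1 y.1 ∨ (x.1 = v ∧ G.Adj u y.1) ∨ (y.1 = v ∧ G.Adj u x.1)) := by
  simp only [contractEdge, SimpleGraph.fromRel_adj]
  have := G.adj_comm x.1 y.1
  have := G.adj_comm x.1 u
  have := G.adj_comm y.1 u
  tauto

/-- if `G ∈ 𝓕_{q,2}` and `e = {u,v}` is an edge lying in no induced
`C₄`, then `G/e ∈ 𝓕_{q,1}`. -/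
theorem memF1_contractEdge_of_memF2 {V : Type*} [Fintype V] [DecidableEq V]
    (q : ℕ) (hq : 1 ≤ q) (G : SimpleGraph V) (hG : MemF2 q G)
    (u v : V) (hadj : G.Adj u v)
    (hC4 : ∀ S : Finset V, u ∈ S → v ∈ S →
      IsEmpty (G.induce (S : Set V) ≃g cycleGraph 4)) :
    MemF1 q (contractEdge G u v) := by
  classical
  obtain ⟨j, hj1, hjq, S, hScard, hVcard, hS, hE⟩ := hG
  obtain ⟨A, B, hdis, hAB, huA, hvB, hbip, hmat⟩ := aux_struct G S hS hE u v hadj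
  have hnAB : ∀ x, x ∈ A → x ∈ B → False := fun x h1 h2 => Finset.disjoint_left.1 hdis h1 h2
  have hAS : ∀ x ∈ A, x ∈ S := fun x h => by rw [← hAB]; exact Finset.mem_union_left _ h
  have hBS : ∀ x ∈ B, x ∈ S := fun x h => by rw [← hAB]; exact Finset.mem_union_right _ h
  have hSAB : ∀ x ∈ S, x ∈ A ∨ x ∈ B := fun x h => by
    rw [← hAB] at h; exact Finset.mem_union.1 h
  have hAtoB : ∀ a b, a ∈ A → G.Adj a b → b ∈ B := fun a b ha h => by
    rcases hbip a b h with h | h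
    · exact h.2
    · exact (hnAB a ha h.1).elim
  have hBtoA : ∀ a b, a ∈ B → G.Adj a b → b ∈ A := fun a b ha h => by
    rcases hbip a b h with h | h
    · exact (hnAB a h.1 ha).elim
    · exact h.2
  have hcsum : A.card + B.card = 2 * j + 2 := by
    rw [← Finset.card_union_of_disjoint hdis, hAB, hScard]
  have hceq : A.card = B.card := by
    obtain ⟨p, hp⟩ := hmat u huA v hvB
    have e1 := Finset.card_erase_add_one huA
    have e2 := Finset.card_erase_add_one hvB
    have hcb : (A.erase u).card = (B.erase v).card := by
      have ne1 : ∀ a ∈ A, a ≠ v := fun a ha h => hnAB v (h ▸ ha) hvB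
      have ne2 : ∀ a ∈ B, a ≠ u := fun a ha h => hnAB u huA (h ▸ ha)
      refine Finset.card_bij' (fun a _ => p a) (fun a _ => p a) ?_ ?_ ?_ ?_
      · intro a ha
        rw [Finset.mem_erase] at ha ⊢
        have := hp a (hAS a ha.2) ha.1 (ne1 a ha.2)
        exact ⟨this.2.2.1, hAtoB _ _ ha.2 this.2.2.2.1⟩
      · intro a ha
        rw [Finset.mem_erase] at ha ⊢
        have := hp a (hBS a ha.2) (ne2 a ha.2) ha.1
        exact ⟨this.2.1, hBtoA _ _ ha.2 this.2.2.2.1⟩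
      · intro a ha
        rw [Finset.mem_erase] at ha
        exact (hp a (hAS a ha.2) ha.1 (ne1 a ha.2)).2.2.2.2
      · intro a ha
        rw [Finset.mem_erase] at ha
        exact (hp a (hBS a ha.2) (ne2 a ha.2) ha.1).2.2.2.2
    omega
  have hcQ : ∀ x, x ∉ A → ((Finset.univ \ A).erase x).card ≤ q := by
    intro x hx
    rw [Finset.card_erase_of_mem (by simp [hx]), Finset.card_sdiff_of_subset (Finset.subset_univ _),
      Finset.card_univ]
    omega
  have hvu : v ≠ u := hadj.ne'
  have hcard' : Fintype.card {a : V // a ≠ u} = q + j + 1 := by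
    have : Fintype.card {a : V // a ≠ u} = Fintype.card V - 1 := by
      simp
    omega
  refine ⟨?_, ?_, ?_⟩
  · rintro ⟨h, -⟩
    omega
  · rintro ⟨f, hf, hun⟩
    have hc : ∀ a : {a : V // a ≠ u}, ∃ i, a ∈ f i := fun a => by
      have : a ∈ ⋃ i, f i := by rw [← hun]; trivial
      exact Set.mem_iUnion.1 this
    choose c hc using hc
    have hcadj : ∀ a b, c a = c b → a ≠ b → (contractEdge G u v).Adj a b := by
      intro a b h hab
      exact hf (c a) (hc a) (h ▸ hc b) hab
    -- adjacency stays in `S`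
    have hadjS : ∀ a b, (contractEdge G u v).Adj a b → a.1 ∈ S := by
      intro a b h
      rw [aux_adj] at h
      rcases h.2 with h | h | h
      · exact (hS _ _ h).1
      · rw [h.1]; exact hBS v hvB
      · exact (hS _ _ h.2).2
    -- no triangles through `v`
    have tri1 : ∀ a b : {a : V // a ≠ u}, a.1 ≠ v → b.1 ≠ v → G.Adj a.1 b.1 →
        (contractEdge G u v).Adj ⟨v, hvu⟩ a → (contractEdge G u v).Adj ⟨v, hvu⟩ b → False := by
      have half : ∀ a b : {a : V // a ≠ u}, a.1 ∈ A → b.1 ∈ B → a.1 ≠ v → b.1 ≠ v →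
          G.Adj a.1 b.1 → (contractEdge G u v).Adj ⟨v, hvu⟩ a →
          (contractEdge G u v).Adj ⟨v, hvu⟩ b → False := by
        intro a b haA hbB hav hbv hab hva hvb
        rw [aux_adj] at hva hvb
        have h1 : G.Adj v a.1 := by
          rcases hva.2 with h | h | h
          · exact h
          · exact (hnAB _ haA (hAtoB _ _ huA h.2)).elim
          · exact (hav h.1).elim
        have h2 : G.Adj u b.1 := by
          rcases hvb.2 with h | h | h
          · exact (hnAB _ (hBtoA _ _ hvB h) hbB).elim
          · exact h.2
          · exact (hbv h.1).elim
        obtain ⟨e⟩ := aux_C4 G u v a.1 b.1 hadj h1 hab h2.symm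
          (fun h => hnAB _ haA (hAtoB _ _ huA h)) (fun h => hnAB _ (hBtoA _ _ hvB h) hbB)
          a.2.symm hbv.symm
        exact (hC4 {u, v, a.1, b.1} (by simp) (by simp)).false e
      intro a b hav hbv hab hva hvb
      rcases hbip _ _ hab with h | h
      · exact half a b h.1 h.2 hav hbv hab hva hvb
      · exact half b a h.2 h.1 hbv hav hab.symm hvb hva
    have toG : ∀ a b : {a : V // a ≠ u}, a.1 ≠ v → b.1 ≠ v →
        (contractEdge G u v).Adj a b → G.Adj a.1 b.1 := by
      intro a b ha hb h
      rw [aux_adj] at h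
      tauto
    have tri : ∀ a b d, (contractEdge G u v).Adj a b → (contractEdge G u v).Adj b d →
        (contractEdge G u v).Adj a d → False := by
      intro a b d hab hbd had
      by_cases ha : a.1 = v
      · have ea : a = ⟨v, hvu⟩ := Subtype.ext ha
        have hb : b.1 ≠ v := fun h => hab.ne (Subtype.ext (ha.trans h.symm))
        have hd : d.1 ≠ v := fun h => had.ne (Subtype.ext (ha.trans h.symm))
        subst ea
        exact tri1 b d hb hd (toG _ _ hb hd hbd) hab had
      by_cases hb : b.1 = v
      · have eb : b = ⟨v, hvu⟩ := Subtype.ext hb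
        have hd : d.1 ≠ v := fun h => hbd.ne (Subtype.ext (hb.trans h.symm))
        subst eb
        exact tri1 a d ha hd (toG _ _ ha hd had) hab.symm hbd
      by_cases hd : d.1 = v
      · have ed : d = ⟨v, hvu⟩ := Subtype.ext hd
        subst ed
        exact tri1 a b ha hb (toG _ _ ha hb hab) had.symm hbd.symm
      have h1 := toG _ _ ha hb hab
      have h2 := toG _ _ hb hd hbd
      have h3 := toG _ _ ha hd had
      rcases hbip _ _ h1 with h | h
      · exact hnAB _ (hBtoA _ _ h.2 h2) (hAtoB _ _ h.1 h3)
      · exact hnAB _ (hBtoA _ _ h.1 h3) (hAtoB _ _ h.2 h2)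
    let S' : Finset {a : V // a ≠ u} := Finset.univ.filter (fun a => a.1 ∈ S)
    let N' : Finset {a : V // a ≠ u} := Finset.univ.filter (fun a => a.1 ∉ S)
    have hsum : S'.card + N'.card = q + j + 1 := by
      rw [← hcard', ← Finset.card_univ]
      exact Finset.card_filter_add_card_filter_not _
    have hS' : S'.card = 2 * j + 1 := by
      have h1 : S'.card = (S.erase u).card := by
        refine Finset.card_bij (fun a _ => a.1) ?_ ?_ ?_
        · intro a ha
          simp only [S', Finset.mem_filter] at ha
          exact Finset.mem_erase.2 ⟨a.2, ha.2⟩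
        · intro a _ b _ h
          exact Subtype.ext h
        · intro b hb
          rw [Finset.mem_erase] at hb
          exact ⟨⟨b, hb.1⟩, by simp [S', hb.2], rfl⟩
      rw [h1, Finset.card_erase_of_mem (hAS u huA)]
      omega
    have hNinj : (N'.image c).card = N'.card := by
      apply Finset.card_image_of_injOn
      intro a ha b hb h
      by_contra hab
      simp only [N', Finset.coe_filter, Set.mem_ofPred_eq] at ha
      exact ha.2 (hadjS a b (hcadj a b h hab))
    have hdisj : Disjoint (S'.image c) (N'.image c) := by
      rw [Finset.disjoint_left]
      intro i h1 h2
      obtain ⟨a, ha, rfl⟩ := Finset.mem_image.1 h1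
      obtain ⟨b, hb, hab⟩ := Finset.mem_image.1 h2
      simp only [S', N', Finset.mem_filter] at ha hb
      exact hb.2 (hadjS b a (hcadj b a hab (fun h => hb.2 (h ▸ ha.2))))
    have hle : (S'.image c).card + (N'.image c).card ≤ q := by
      rw [← Finset.card_union_of_disjoint hdisj]
      exact (Finset.card_le_univ _).trans (by simp)
    have h2 : S'.card ≤ 2 * (S'.image c).card := by
      apply Finset.card_le_mul_card_image
      intro i _
      by_contra hlt
      push Not at hlt
      obtain ⟨a, b, d, ha, hb, hd, hab, had, hbd⟩ := Finset.two_lt_card_iff.1 hlt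
      simp only [Finset.mem_filter] at ha hb hd
      exact tri a b d (hcadj _ _ (ha.2.trans hb.2.symm) hab)
        (hcadj _ _ (hb.2.trans hd.2.symm) hbd) (hcadj _ _ (ha.2.trans hd.2.symm) had)
    omega
  · intro T hT
    obtain ⟨x, hxT⟩ := (Set.ne_univ_iff_exists_notMem T).1 hT
    have hTx : ∀ a ∈ T, a.1 ≠ x.1 := fun a ha h => hxT (Subtype.ext h ▸ ha)
    by_cases hxA : x.1 ∈ A
    · obtain ⟨p, hp⟩ := hmat x.1 hxA v hvB
      have ne1 : ∀ a ∈ A, a ≠ v := fun a ha h => hnAB v (h ▸ ha) hvB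
      have hpA : ∀ a ∈ A, a ≠ x.1 → p a ∈ B ∧ p a ≠ v ∧ G.Adj a (p a) ∧ p (p a) = a := by
        intro a ha hax
        have := hp a (hAS a ha) hax (ne1 a ha)
        exact ⟨hAtoB _ _ ha this.2.2.2.1, this.2.2.1, this.2.2.2.1, this.2.2.2.2⟩
      have hpu := hpA u huA x.2.symm
      have hvA : v ∉ A := fun h => hnAB v h hvB
      refine aux_cover _ q T (fun a => if a.1 = v then p u else if a.1 ∈ A then p a.1 else a.1)
        ((Finset.univ \ A).erase v) (hcQ v hvA) ?_ ?_
      · intro a ha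
        have hax := hTx a ha
        simp only [Finset.mem_erase, Finset.mem_sdiff, Finset.mem_univ, true_and]
        split_ifs with h1 h2
        · exact ⟨hpu.2.1, fun h => hnAB _ h hpu.1⟩
        · have := hpA _ h2 hax
          exact ⟨this.2.1, fun h => hnAB _ h this.1⟩
        · exact ⟨h1, h2⟩
      · intro a ha b hb hab h
        have hax := hTx a ha
        have hbx := hTx b hb
        have hab' : a.1 ≠ b.1 := fun h => hab (Subtype.ext h)
        rw [aux_adj]
        refine ⟨hab, ?_⟩
        have hinj : ∀ y ∈ A, ∀ z ∈ A, y ≠ x.1 → z ≠ x.1 → p y = p z → y = z := by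
          intro y hy z hz hyx hzx hyz
          rw [← (hpA y hy hyx).2.2.2, hyz, (hpA z hz hzx).2.2.2]
        split_ifs at h with h1 h2 h3 h4 h5 h6 h7
        · exact (hab' (h1.trans h2.symm)).elim
        · exact (b.2 (hinj _ huA _ h3 x.2.symm hbx h).symm).elim
        · exact Or.inr (Or.inl ⟨h1, h ▸ hpu.2.2.1⟩)
        · exact (a.2 (hinj _ h4 _ huA hax x.2.symm h)).elim
        · exact (hab' (hinj _ h4 _ h6 hax hbx h)).elim
        · exact Or.inl (h ▸ (hpA _ h4 hax).2.2.1)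
        · exact Or.inr (Or.inr ⟨h7, h ▸ hpu.2.2.1⟩)
        · rename_i h8
          exact Or.inl (h.symm ▸ (hpA _ h8 hbx).2.2.1.symm)
        · exact (hab' h).elim
    · obtain ⟨y, hyB, hyx⟩ : ∃ y ∈ B, x.1 ∈ B → y = x.1 := by
        by_cases hxB : x.1 ∈ B
        · exact ⟨x.1, hxB, fun _ => rfl⟩
        · exact ⟨v, hvB, fun h => (hxB h).elim⟩
      obtain ⟨p, hp⟩ := hmat u huA y hyB
      have ne1 : ∀ a ∈ A, a ≠ y := fun a ha h => hnAB y (h ▸ ha) hyB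
      have hpA : ∀ a ∈ A, a ≠ u → p a ∈ B ∧ p a ≠ y ∧ G.Adj a (p a) ∧ p (p a) = a := by
        intro a ha hax
        have := hp a (hAS a ha) hax (ne1 a ha)
        exact ⟨hAtoB _ _ ha this.2.2.2.1, this.2.2.1, this.2.2.2.1, this.2.2.2.2⟩
      refine aux_cover _ q T (fun a => if a.1 ∈ A then p a.1 else a.1)
        ((Finset.univ \ A).erase x.1) (hcQ x.1 hxA) ?_ ?_
      · intro a ha
        have hax := hTx a ha
        simp only [Finset.mem_erase, Finset.mem_sdiff, Finset.mem_univ, true_and]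
        split_ifs with h2
        · have := hpA _ h2 a.2
          exact ⟨fun h => this.2.1 (h.trans (hyx (h ▸ this.1)).symm), fun h => hnAB _ h this.1⟩
        · exact ⟨hax, h2⟩
      · intro a ha b hb hab h
        have hab' : a.1 ≠ b.1 := fun h => hab (Subtype.ext h)
        rw [aux_adj]
        refine ⟨hab, Or.inl ?_⟩
        split_ifs at h with h1 h2 h3
        · refine (hab' ?_).elim
          rw [← (hpA _ h1 a.2).2.2.2, h, (hpA _ h2 b.2).2.2.2]
        · exact h ▸ (hpA _ h1 a.2).2.2.1
        · exact h.symm ▸ (hpA _ h3 b.2).2.2.1.symm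
        · exact (hab' h).elim
end

section
/- Let G be a finite simple graph on r+1 vertices such that for every edge e of G the edge contraction G/e is bipartite. Then G is a forest, or G is isomorphic to the disjoint union C_n ⊔ K̄_{r+1−n} of a cycle C_n and r+1−n isolated vertices for some odd integer n with 3 ≤ n ≤ r+1. -/
open SimpleGraph Finset

lemma contract_coloring {V : Type*} [DecidableEq V] (G : SimpleGraph V) (u v : V)
    (huv : G.Adj u v) (h : (contractEdge G u v).Colorable 2) :
    ∃ f : V → ZMod 2, ∀ a b, G.Adj a b →
      f a + f b = 1 + (if s(a, b) = s(u, v) then 1 else 0) := by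
  obtain ⟨c⟩ := h
  have hvu : v ≠ u := huv.ne'
  let g : Fin 2 → ZMod 2 := fun x => x
  have hg : ∀ x y : Fin 2, x ≠ y → g x + g y = 1 := by
    intro x y h; fin_cases x <;> fin_cases y <;> first | rfl | exact absurd rfl h
  have hg2 : ∀ x : Fin 2, g x + g x = 1 + 1 := by
    intro x; fin_cases x <;> rfl
  let p : V → {a : V // a ≠ u} := fun a => if h : a = u then ⟨v, hvu⟩ else ⟨a, h⟩
  have pu : p u = ⟨v, hvu⟩ := by simp [p]
  have pn : ∀ a (h : a ≠ u), p a = ⟨a, h⟩ := fun a h => by simp [p, h]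
  refine ⟨fun a => g (c (p a)), fun a b hab => ?_⟩
  split_ifs with he
  · have : p a = p b := by
      rcases Sym2.eq_iff.mp he with ⟨rfl, rfl⟩ | ⟨rfl, rfl⟩
      · rw [pu, pn _ hvu]
      · rw [pu, pn _ hvu]
    simp only [this, hg2]
  · rw [add_zero]
    apply hg
    apply c.valid
    have hne := hab.ne
    rw [Sym2.eq_iff] at he
    unfold contractEdge
    rw [SimpleGraph.fromRel_adj]
    by_cases ha : a = u
    · subst ha
      have hb : b ≠ a := hne.symm
      rw [pu, pn b hb]
      refine ⟨?_, Or.inl (Or.inr (Or.inl ⟨rfl, hab⟩))⟩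
      intro h
      have h2 := congrArg Subtype.val h
      simp at h2
      exact he (Or.inl ⟨rfl, h2.symm⟩)
    · by_cases hb : b = u
      · subst hb
        rw [pu, pn a ha]
        refine ⟨?_, Or.inl (Or.inr (Or.inr ⟨rfl, hab⟩))⟩
        intro h
        have h2 := congrArg Subtype.val h
        simp at h2
        exact he (Or.inr ⟨h2, rfl⟩)
      · rw [pn a ha, pn b hb]
        exact ⟨fun h => hne (congrArg Subtype.val h), Or.inl (Or.inl hab)⟩

lemma walk_parity {V : Type*} [DecidableEq V] (G : SimpleGraph V) (e : Sym2 V) (f : V → ZMod 2)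
    (hf : ∀ a b, G.Adj a b → f a + f b = 1 + (if s(a, b) = e then 1 else 0))
    {x y : V} (p : G.Walk x y) : f x + f y = (p.length : ZMod 2) + (p.edges.count e : ℕ) := by
  induction p with
  | nil => simp [CharTwo.add_self_eq_zero]
  | @cons a b c h q ih =>
    have h1 := hf a b h
    have h2 : f b + f b = 0 := CharTwo.add_self_eq_zero _
    rw [SimpleGraph.Walk.length_cons, SimpleGraph.Walk.edges_cons, List.count_cons]
    push_cast
    simp only [beq_iff_eq]
    linear_combination h1 + ih - h2

lemma cycle_iso {V : Type*} [Fintype V] [DecidableEq V] (G : SimpleGraph V) {x : V}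
    (c : G.Walk x x) (hc : c.IsCycle) (hall : ∀ a b, G.Adj a b → s(a, b) ∈ c.edges) :
    ∃ S : Finset V, S.card = c.length ∧ (∀ a b : V, G.Adj a b → a ∈ S ∧ b ∈ S) ∧
          Nonempty (G.induce (S : Set V) ≃g cycleGraph c.length) := by
  have h3 := hc.three_le_length
  generalize hn : c.length = n at *
  have hinj : ∀ i j, i < n → j < n → c.getVert i = c.getVert j → i = j := fun i j hi hj h =>
    hc.getVert_injOn' (by simp only [Set.mem_ofPred_eq]; omega)
      (by simp only [Set.mem_ofPred_eq]; omega) h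
  have hper : ∀ i, i < n → c.getVert (i + 1) = c.getVert ((i + 1) % n) := by
    intro i hi
    rcases Nat.lt_or_ge (i + 1) n with h | h
    · rw [Nat.mod_eq_of_lt h]
    · have : i + 1 = n := by omega
      rw [this, Nat.mod_self, ← hn]
      simp
  have hadj : ∀ i, i < n → G.Adj (c.getVert i) (c.getVert ((i + 1) % n)) := fun i hi => by
    rw [← hper i hi]; exact c.adj_getVert_succ (by omega)
  have hall' : ∀ a b, G.Adj a b → ∃ i < n, 
      (a = c.getVert i ∧ b = c.getVert ((i + 1) % n)) ∨
      (b = c.getVert i ∧ a = c.getVert ((i + 1) % n)) := by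
    intro a b hab
    obtain ⟨i, hi, h⟩ := (c.mk_mem_edges_iff_exists).mp (hall a b hab)
    rw [hn] at hi
    refine ⟨i, hi, ?_⟩
    rw [hper i hi] at h
    rcases Sym2.eq_iff.mp h with ⟨h1, h2⟩ | ⟨h1, h2⟩
    · exact Or.inl ⟨h1.symm, h2.symm⟩
    · exact Or.inr ⟨h1.symm, h2.symm⟩
  let S : Finset V := Finset.univ.image (fun i : Fin n => c.getVert i)
  have hS : ∀ i, i < n → c.getVert i ∈ S := fun i hi =>
    Finset.mem_image.mpr ⟨⟨i, hi⟩, Finset.mem_univ _, rfl⟩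
  have hmod : ∀ i, i % n < n := fun i => Nat.mod_lt _ (by omega)
  let φ : Fin n → (S : Set V) := fun i => ⟨c.getVert i, hS i i.2⟩
  have hφ : Function.Bijective φ := by
    constructor
    · intro i j h
      exact Fin.ext (hinj i j i.2 j.2 (congrArg Subtype.val h))
    · rintro ⟨a, ha⟩
      obtain ⟨i, -, hi⟩ := Finset.mem_image.mp (Finset.mem_coe.mp ha)
      exact ⟨i, Subtype.ext hi⟩
  have key : ∀ i j : Fin n, G.Adj (c.getVert i) (c.getVert j) ↔
      (j.1 = (i.1 + 1) % n ∨ i.1 = (j.1 + 1) % n) := by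
    intro i j
    constructor
    · intro h
      obtain ⟨k, hk, ⟨h1, h2⟩ | ⟨h1, h2⟩⟩ := hall' _ _ h
      · have e1 := hinj _ _ i.2 hk h1
        have e2 := hinj _ _ j.2 (hmod _) h2
        left; rw [e2, e1]
      · have e1 := hinj _ _ j.2 hk h1
        have e2 := hinj _ _ i.2 (hmod _) h2
        right; rw [e2, e1]
    · rintro (h | h)
      · rw [h]; exact hadj i i.2
      · rw [h]; exact (hadj j j.2).symm
  have harith : ∀ i j : Fin n, (i - j).val = 1 ↔ i.1 = (j.1 + 1) % n := by
    intro i j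
    have hi := i.2
    have hj := j.2
    rw [Fin.sub_def]
    simp only
    have e1 : (n - j.1 + i.1) % n = if i.1 < j.1 then n - j.1 + i.1 else i.1 - j.1 := by
      split_ifs with h
      · exact Nat.mod_eq_of_lt (by omega)
      · rw [show n - j.1 + i.1 = (i.1 - j.1) + n by omega, Nat.add_mod_right]
        exact Nat.mod_eq_of_lt (by omega)
    have e2 : (j.1 + 1) % n = if j.1 + 1 = n then 0 else j.1 + 1 := by
      split_ifs with h
      · rw [h, Nat.mod_self]
      · exact Nat.mod_eq_of_lt (by omega)
    rw [e1, e2]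
    split_ifs <;> omega
  refine ⟨S, ?_, ?_, ?_⟩
  · rw [Finset.card_image_of_injective, Finset.card_univ, Fintype.card_fin]
    intro i j h
    exact Fin.ext (hinj i j i.2 j.2 h)
  · intro a b hab
    obtain ⟨k, hk, ⟨h1, h2⟩ | ⟨h1, h2⟩⟩ := hall' _ _ hab
    · rw [h1, h2]; exact ⟨hS _ hk, hS _ (hmod _)⟩
    · rw [h1, h2]; exact ⟨hS _ (hmod _), hS _ hk⟩
  · refine ⟨RelIso.symm ⟨Equiv.ofBijective φ hφ, ?_⟩⟩
    intro i j
    rw [cycleGraph_adj', harith, harith]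
    change G.Adj (c.getVert i) (c.getVert j) ↔ _
    rw [key, or_comm]

/-- if every edge contraction of `G` is bipartite, then `G` is a forest,
or `G` is a (odd) cycle `C_n` together with `r+1-n` isolated vertices. -/
theorem forest_or_odd_cycle_of_contractions_bipartite {V : Type*} [Fintype V] [DecidableEq V]
    (r : ℕ) (hcard : Fintype.card V = r + 1) (G : SimpleGraph V)
    (hbip : ∀ u v : V, G.Adj u v → (contractEdge G u v).Colorable 2) :
    G.IsAcyclic ∨
      ∃ n : ℕ, Odd n ∧ 3 ≤ n ∧ n ≤ r + 1 ∧
        ∃ S : Finset V, S.card = n ∧ (∀ a b : V, G.Adj a b → a ∈ S ∧ b ∈ S) ∧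
          Nonempty (G.induce (S : Set V) ≃g cycleGraph n) := by
  by_cases hac : G.IsAcyclic
  · exact Or.inl hac
  right
  unfold SimpleGraph.IsAcyclic at hac
  push Not at hac
  obtain ⟨x, c, hc⟩ := hac
  have h3 := hc.three_le_length
  have hpar : ∀ a b, G.Adj a b → Even (c.length + c.edges.count s(a, b)) := by
    intro a b hab
    obtain ⟨f, hf⟩ := contract_coloring G a b hab (hbip a b hab)
    have h := walk_parity G s(a, b) f hf c
    rw [CharTwo.add_self_eq_zero] at h
    rw [← ZMod.natCast_eq_zero_iff_even]
    push_cast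
    exact h.symm
  have hodd : Odd c.length := by
    have hadj : G.Adj (c.getVert 0) (c.getVert (0 + 1)) := c.adj_getVert_succ (by omega)
    have hmem : s(c.getVert 0, c.getVert (0 + 1)) ∈ c.edges :=
      (c.mk_mem_edges_iff_exists).mpr ⟨0, by omega, rfl⟩
    have h := hpar _ _ hadj
    rw [List.count_eq_one_of_mem hc.isCircuit.isTrail.edges_nodup hmem] at h
    rw [Nat.even_add_one] at h
    exact Nat.not_even_iff_odd.mp h
  have hall : ∀ a b, G.Adj a b → s(a, b) ∈ c.edges := by
    intro a b hab
    by_contra hn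
    have h := hpar _ _ hab
    rw [List.count_eq_zero_of_not_mem hn, add_zero] at h
    exact Nat.not_even_iff_odd.mpr hodd h
  obtain ⟨S, hS, h1, h2⟩ := cycle_iso G c hc hall
  exact ⟨c.length, hodd, h3, by rw [← hcard, ← hS]; exact Finset.card_le_univ S, S, hS, h1, h2⟩
end

section
/- Let G be a finite simple graph and q ≥ 1 an integer. If G is F_{q,2}-free and C_{2q+4}-free, then G is F_{q+1,2}-free. -/
open SimpleGraph Finset

def Strong {ι : Type*} (R : ι → ι → Prop) (T : Finset ι) : Prop :=
  ∀ A ⊆ T, A.Nonempty → (∀ a ∈ A, ∀ b ∈ T, R a b → b ∈ A) → A = T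

lemma strong_singleton {ι : Type*} [DecidableEq ι] (R : ι → ι → Prop) (a : ι) :
    Strong R {a} := by
  intro A hA hne _
  exact (Finset.subset_singleton_iff.1 hA).resolve_left hne.ne_empty

open Classical in
lemma strong_scc {ι : Type*} [Fintype ι] (R r : ι → ι → Prop) (hr : ∀ x y, r x y → R x y)
    (t : ι) : Strong R (Finset.univ.filter fun x =>
      Relation.ReflTransGen r t x ∧ Relation.ReflTransGen r x t) := by
  intro A hA ⟨a, ha⟩ hcl
  refine Finset.Subset.antisymm hA ?_
  intro b hb
  have haS := hA ha
  simp only [Finset.mem_filter, Finset.mem_univ, true_and] at hb haS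
  have hab : Relation.ReflTransGen r a b := haS.2.trans hb.1
  have key : ∀ x, Relation.ReflTransGen r a x → Relation.ReflTransGen r x b → x ∈ A := by
    intro x hx
    induction hx with
    | refl => intro _; exact ha
    | tail h1 h2 ih =>
      intro h3
      refine hcl _ (ih (h3.head h2)) _ ?_ (hr _ _ h2)
      simp only [Finset.mem_filter, Finset.mem_univ, true_and]
      exact ⟨haS.1.trans (h1.tail h2), h3.trans hb.2⟩
  exact key b hab .refl

open Classical in
lemma strong_step {ι : Type*} [Fintype ι] (R : ι → ι → Prop)
    (T : Finset ι) (hT : Strong R T) (hne : T.Nonempty)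
    (hmax : ∀ S, T ⊂ S → Strong R S → S = Finset.univ)
    (c c' : ι) (hc : c ∉ T) (hc' : c' ∉ T) (hcc : c ≠ c')
    (t : ι) (ht : t ∈ T) (hct : R c t)
    (y t0 : ι) (ht0 : t0 ∈ T)
    (hy : Relation.ReflTransGen (fun a b => R a b ∧ a ≠ c' ∧ b ≠ c') t0 y) (hyc' : y ≠ c')
    (hyc : R y c) : False := by
  set r : ι → ι → Prop := fun a b => R a b ∧ a ≠ c' ∧ b ≠ c' with hrdef
  have hr : ∀ x y, r x y → R x y := fun x y h => h.1
  have hS := strong_scc R r hr t0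
  have hTne : ∀ x ∈ T, x ≠ c' := fun x hx h => hc' (h ▸ hx)
  have h1 : T.filter (fun x => Relation.ReflTransGen r t0 x) = T := by
    apply hT _ (Finset.filter_subset _ _) ⟨t0, by simp [ht0, Relation.ReflTransGen.refl]⟩
    intro a ha b hb hab
    simp only [Finset.mem_filter] at ha ⊢
    exact ⟨hb, ha.2.tail ⟨hab, hTne a ha.1, hTne b hb⟩⟩
  have h2 : ∀ x ∈ T, Relation.ReflTransGen r x t0 := by
    by_contra! hx
    obtain ⟨x, hxT, hx⟩ := hx
    have : T.filter (fun x => ¬ Relation.ReflTransGen r x t0) = T := by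
      apply hT _ (Finset.filter_subset _ _) ⟨x, by simp [hxT, hx]⟩
      intro a ha b hb hab
      simp only [Finset.mem_filter] at ha ⊢
      exact ⟨hb, fun h => ha.2 (h.head ⟨hab, hTne a ha.1, hTne b hb⟩)⟩
    rw [← this] at ht0
    simp only [Finset.mem_filter] at ht0
    exact ht0.2 .refl
  have hcS : c ∈ (Finset.univ.filter fun x =>
      Relation.ReflTransGen r t0 x ∧ Relation.ReflTransGen r x t0) := by
    simp only [Finset.mem_filter, Finset.mem_univ, true_and]
    exact ⟨hy.tail ⟨hyc, hyc', hcc⟩, (h2 t ht).head ⟨hct, hcc, hTne t ht⟩⟩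
  have hsub : T ⊂ (Finset.univ.filter fun x =>
      Relation.ReflTransGen r t0 x ∧ Relation.ReflTransGen r x t0) := by
    refine (Finset.ssubset_iff_of_subset ?_).2 ⟨c, hcS, hc⟩
    intro x hx
    simp only [Finset.mem_filter, Finset.mem_univ, true_and]
    refine ⟨?_, h2 x hx⟩
    rw [← h1] at hx
    exact (Finset.mem_filter.1 hx).2
  have hu := hmax _ hsub hS
  have hc'S := Finset.mem_univ c'
  rw [← hu] at hc'S
  simp only [Finset.mem_filter, Finset.mem_univ, true_and] at hc'S
  rcases Relation.ReflTransGen.cases_tail hc'S.1 with h | ⟨z, _, hz⟩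
  · exact hTne t0 ht0 h.symm
  · exact hz.2.2 rfl

open Classical in
lemma strong_unique {ι : Type*} [Fintype ι] (R : ι → ι → Prop)
    (hU : Strong R Finset.univ)
    (T : Finset ι) (hT : Strong R T) (hne : T.Nonempty)
    (hmax : ∀ S, T ⊂ S → Strong R S → S = Finset.univ)
    (c c' : ι) (hc : c ∉ T) (hc' : c' ∉ T)
    (t : ι) (ht : t ∈ T) (hct : R c t)
    (t' : ι) (ht' : t' ∈ T) (hct' : R c' t') : c = c' := by
  by_contra hcc
  obtain ⟨t0, ht0⟩ := hne
  set r : ι → ι → Prop := fun a b => R a b ∧ a ≠ c ∧ a ≠ c' ∧ b ≠ c ∧ b ≠ c' with hrdef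
  set X := Finset.univ.filter (fun x => Relation.ReflTransGen r t0 x) with hX
  have hXne : ∀ x ∈ X, x ≠ c ∧ x ≠ c' := by
    intro x hx
    rw [hX, Finset.mem_filter] at hx
    rcases Relation.ReflTransGen.cases_tail hx.2 with h | ⟨z, _, hz⟩
    · exact ⟨fun h' => hc (h' ▸ h ▸ ht0), fun h' => hc' (h' ▸ h ▸ ht0)⟩
    · exact hz.2.2.2
  by_cases hcl : ∀ a ∈ X, ∀ b ∈ Finset.univ, R a b → b ∈ X
  · have := hU X (Finset.subset_univ _) ⟨t0, by simp [hX, Relation.ReflTransGen.refl]⟩ hcl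
    have h := Finset.mem_univ c
    rw [← this] at h
    exact (hXne c h).1 rfl
  · push Not at hcl
    obtain ⟨a, ha, b, -, hab, hb⟩ := hcl
    have hra := (Finset.mem_filter.1 ha).2
    have hb' : b = c ∨ b = c' := by
      by_contra! h
      apply hb
      rw [hX, Finset.mem_filter]
      exact ⟨Finset.mem_univ _, hra.tail ⟨hab, (hXne a ha).1, (hXne a ha).2, h.1, h.2⟩⟩
    rcases hb' with rfl | rfl
    · refine strong_step R T hT ⟨t0, ht0⟩ hmax b c' hc hc' hcc t ht hct a t0 ht0
        (Relation.ReflTransGen.mono ?_ _ _ hra) (hXne a ha).2 hab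
      rintro x y ⟨h1, h2, h3, h4, h5⟩
      exact ⟨h1, h3, h5⟩
    · refine strong_step R T hT ⟨t0, ht0⟩ hmax b c hc' hc (Ne.symm hcc) t' ht' hct' a t0 ht0
        (Relation.ReflTransGen.mono ?_ _ _ hra) (hXne a ha).1 hab
      rintro x y ⟨h1, h2, h3, h4, h5⟩
      exact ⟨h1, h2, h4⟩

/-- Hall step. -/
lemma strong_hall {ι : Type*} [Fintype ι] [DecidableEq ι] (R : ι → ι → Prop)
    (hrefl : ∀ i, R i i) (T : Finset ι) (hT : Strong R T) (i j : ι) (hi : i ∈ T) (hj : j ∈ T) :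
    ∃ f : ι → ι, Set.BijOn f (T.erase i) (T.erase j) ∧ ∀ x ∈ T.erase i, R x (f x) := by
  classical
  let N : {x // x ∈ T.erase i} → Finset ι := fun x => (T.erase j).filter (fun y => R x y)
  have hall : ∀ s : Finset {x // x ∈ T.erase i}, s.card ≤ (s.biUnion N).card := by
    intro s
    rcases s.eq_empty_or_nonempty with rfl | hs
    · simp
    set A : Finset ι := s.map (Function.Embedding.subtype _) with hA
    have hAT : A ⊆ T.erase i := by
      intro x hx
      simp only [hA, Finset.mem_map, Function.Embedding.subtype_apply] at hx
      obtain ⟨y, _, rfl⟩ := hx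
      exact y.2
    have hAne : A.Nonempty := hs.map
    have hcard : A.card = s.card := Finset.card_map _
    have hnc : ¬ ∀ a ∈ A, ∀ b ∈ T, R a b → b ∈ A := by
      intro h
      have := hT A (hAT.trans (Finset.erase_subset _ _)) hAne h
      rw [← this] at hi
      exact absurd (hAT hi) (Finset.notMem_erase _ _)
    push Not at hnc
    obtain ⟨a, ha, b, hb, hab, hbA⟩ := hnc
    have hsub : (insert b A).erase j ⊆ s.biUnion N := by
      intro y hy
      rw [Finset.mem_erase, Finset.mem_insert] at hy
      obtain ⟨hyj, hy⟩ := hy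
      rw [Finset.mem_biUnion]
      rcases hy with rfl | hy
      · simp only [hA, Finset.mem_map, Function.Embedding.subtype_apply] at ha
        obtain ⟨a', ha', rfl⟩ := ha
        exact ⟨a', ha', by simp [N, hyj, hb, hab]⟩
      · have hyT := hAT hy
        simp only [hA, Finset.mem_map, Function.Embedding.subtype_apply] at hy
        obtain ⟨a', ha', rfl⟩ := hy
        exact ⟨a', ha', by simp [N, hyj, Finset.mem_of_mem_erase hyT, hrefl]⟩
    have h1 := Finset.card_le_card hsub
    have h2 := Finset.pred_card_le_card_erase (s := insert b A) (a := j)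
    rw [Finset.card_insert_of_notMem hbA] at h2
    omega
  obtain ⟨f, hf, hfN⟩ := (Finset.all_card_le_biUnion_card_iff_exists_injective N).1 hall
  let g : ι → ι := fun x => if h : x ∈ T.erase i then f ⟨x, h⟩ else x
  have hg : ∀ x (h : x ∈ T.erase i), g x = f ⟨x, h⟩ := fun x h => dif_pos h
  have hm : ∀ x ∈ T.erase i, g x ∈ T.erase j ∧ R x (g x) := by
    intro x h
    rw [hg x h]
    exact Finset.mem_filter.1 (hfN ⟨x, h⟩)
  have hinj : Set.InjOn g (T.erase i : Finset ι) := by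
    intro x hx y hy hxy
    rw [hg x hx, hg y hy] at hxy
    exact congrArg Subtype.val (hf hxy)
  refine ⟨g, ⟨fun x hx => (hm x hx).1, hinj, ?_⟩, fun x hx => (hm x hx).2⟩
  apply Finset.surjOn_of_injOn_of_card_le g (fun x hx => (hm x hx).1) hinj
  rw [Finset.card_erase_of_mem hi, Finset.card_erase_of_mem hj]

lemma elem_of_strong {V ι : Type*} [DecidableEq V] [Fintype ι] [DecidableEq ι] (G : SimpleGraph V)
    (u w : ι → V) (hu : Function.Injective u) (hw : Function.Injective w)
    (huw : ∀ i j, u i ≠ w j) (huu : ∀ i j, ¬ G.Adj (u i) (u j))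
    (hww : ∀ i j, ¬ G.Adj (w i) (w j)) (hm : ∀ i, G.Adj (u i) (w i))
    (T : Finset ι) (hT : Strong (fun i j => G.Adj (u i) (w j)) T) :
    ElemBipartite (G.induce ((T.image u ∪ T.image w : Finset V) : Set V)) := by
  refine ⟨{x | x.1 ∈ T.image u}, {x | x.1 ∈ T.image w}, ?_, ?_, ?_, ?_⟩
  · rw [Set.disjoint_left]
    rintro ⟨x, hx⟩ h1 h2
    simp only [Set.mem_ofPred_eq, Finset.mem_image] at h1 h2
    obtain ⟨i, _, rfl⟩ := h1
    obtain ⟨j, _, h⟩ := h2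
    exact huw _ _ h.symm
  · ext ⟨x, hx⟩
    simpa using hx
  · rintro ⟨x, hx⟩ ⟨y, hy⟩ h
    simp only [SimpleGraph.comap_adj, Function.Embedding.subtype_apply] at h
    simp only [Finset.coe_union, Finset.coe_image, Set.mem_union, Set.mem_image,
      Finset.mem_coe] at hx hy
    simp only [Set.mem_ofPred_eq, Finset.mem_image]
    rcases hx with ⟨i, hi, rfl⟩ | ⟨i, hi, rfl⟩ <;> rcases hy with ⟨j, hj, rfl⟩ | ⟨j, hj, rfl⟩
    · exact absurd h (huu _ _)
    · exact Or.inl ⟨⟨i, hi, rfl⟩, ⟨j, hj, rfl⟩⟩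
    · exact Or.inr ⟨⟨i, hi, rfl⟩, ⟨j, hj, rfl⟩⟩
    · exact absurd h (hww _ _)
  · rintro ⟨x, hx⟩ hxu ⟨y, hy⟩ hyw
    simp only [Set.mem_ofPred_eq, Finset.mem_image] at hxu hyw
    obtain ⟨i, hi, rfl⟩ := hxu
    obtain ⟨j, hj, rfl⟩ := hyw
    obtain ⟨f, hf, hfR⟩ := strong_hall _ hm T hT i j hi hj
    have hfm : ∀ k ∈ T.erase i, f k ∈ T.erase j := fun k hk => hf.1 hk
    refine ⟨{ verts := Set.univ \ {⟨u i, hx⟩, ⟨w j, hy⟩},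
              Adj := fun a b => ∃ k ∈ T.erase i,
                (a.1 = u k ∧ b.1 = w (f k)) ∨ (b.1 = u k ∧ a.1 = w (f k)),
              adj_sub := ?_, edge_vert := ?_, symm := ?_ }, rfl, ?_⟩
    · rintro ⟨a, ha⟩ ⟨b, hb⟩ ⟨k, hk, ⟨h1, h2⟩ | ⟨h1, h2⟩⟩
      · simp only at h1 h2; subst h1 h2
        exact hfR k hk
      · simp only at h1 h2; subst h1 h2
        exact (hfR k hk).symm
    · rintro ⟨a, ha⟩ ⟨b, hb⟩ ⟨k, hk, ⟨h1, h2⟩ | ⟨h1, h2⟩⟩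
      · simp only at h1 h2; subst h1 h2
        simp only [Set.mem_sdiff, Set.mem_univ, Set.mem_insert_iff, Set.mem_singleton_iff,
          Subtype.mk.injEq, true_and, not_or]
        exact ⟨fun h => (Finset.mem_erase.1 hk).1 (hu h), huw _ _⟩
      · simp only at h1 h2; subst h1 h2
        simp only [Set.mem_sdiff, Set.mem_univ, Set.mem_insert_iff, Set.mem_singleton_iff,
          Subtype.mk.injEq, true_and, not_or]
        exact ⟨fun h => huw _ _ h.symm, fun h => (Finset.mem_erase.1 (hfm k hk)).1 (hw h)⟩
    · exact ⟨fun a b ⟨k, hk, h⟩ => ⟨k, hk, h.symm⟩⟩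
    · rintro ⟨a, ha⟩ hav
      simp only [Set.mem_sdiff, Set.mem_univ, Set.mem_insert_iff, Set.mem_singleton_iff,
          Subtype.mk.injEq, true_and, not_or] at hav
      have ha' := ha
      simp only [Finset.coe_union, Finset.coe_image, Set.mem_union, Set.mem_image,
        Finset.mem_coe] at ha'
      rcases ha' with ⟨k, hk, rfl⟩ | ⟨k, hk, rfl⟩
      · have hk' : k ∈ T.erase i := Finset.mem_erase.2 ⟨fun h => hav.1 (h ▸ rfl), hk⟩
        have := Finset.mem_of_mem_erase (hfm k hk')
        refine ⟨⟨w (f k), by simp; exact Or.inr ⟨_, this, rfl⟩⟩, ⟨k, hk', Or.inl ⟨rfl, rfl⟩⟩, ?_⟩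
        rintro ⟨b, hb⟩ ⟨l, hl, ⟨h1, h2⟩ | ⟨h1, h2⟩⟩
        · simp only at h1 h2
          have := hu h1
          subst this
          exact Subtype.ext h2
        · exact absurd h2 (huw _ _)
      · have hk' : k ∈ T.erase j := Finset.mem_erase.2 ⟨fun h => hav.2 (h ▸ rfl), hk⟩
        obtain ⟨l, hl, rfl⟩ := hf.2.2 hk'
        have hlT := Finset.mem_of_mem_erase (Finset.mem_coe.1 hl)
        refine ⟨⟨u l, by simp; exact Or.inl ⟨_, hlT, rfl⟩⟩, ⟨l, hl, Or.inr ⟨rfl, rfl⟩⟩, ?_⟩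
        rintro ⟨b, hb⟩ ⟨m, hm', ⟨h1, h2⟩ | ⟨h1, h2⟩⟩
        · exact absurd h1.symm (huw _ _)
        · simp only at h1 h2
          have := hf.2.1 hl hm' (hw h2)
          subst this
          exact Subtype.ext h1

lemma cyc_adj (N : ℕ) (hN : 2 ≤ N) (a b : Fin N) :
    (cycleGraph N).Adj a b ↔ (a.val = b.val + 1 ∨ b.val = a.val + 1 ∨
      (a.val = 0 ∧ b.val + 1 = N) ∨ (b.val = 0 ∧ a.val + 1 = N)) := by
  rw [cycleGraph_adj']
  have ha := a.2
  have hb := b.2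
  rcases lt_trichotomy a b with h | h | h
  · rw [Fin.coe_sub_iff_lt.2 h, Fin.coe_sub_iff_le.2 h.le]
    rw [Fin.lt_def] at h
    omega
  · subst h
    rw [Fin.coe_sub_iff_le.2 le_rfl]
    omega
  · rw [Fin.coe_sub_iff_lt.2 h, Fin.coe_sub_iff_le.2 h.le]
    rw [Fin.lt_def] at h
    omega

lemma cycle_case {V ι : Type*} [DecidableEq V] [Fintype ι] [DecidableEq ι] (G : SimpleGraph V)
    (u w : ι → V) (hu : Function.Injective u) (hw : Function.Injective w)
    (huw : ∀ i j, u i ≠ w j) (huu : ∀ i j, ¬ G.Adj (u i) (u j))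
    (hww : ∀ i j, ¬ G.Adj (w i) (w j)) (hm : ∀ i, G.Adj (u i) (w i))
    (hT : Strong (fun i j => G.Adj (u i) (w j)) Finset.univ)
    (n : ℕ) (hn : Fintype.card ι = n) (hn2 : 2 ≤ n)
    (hin : ∀ a c c', c ≠ a → c' ≠ a → G.Adj (u c) (w a) → G.Adj (u c') (w a) → c = c') :
    ∃ S : Finset V, Nonempty (G.induce (S : Set V) ≃g cycleGraph (2 * n)) := by
  classical
  have hp : ∀ a, ∃ c, c ≠ a ∧ G.Adj (u c) (w a) := by
    intro a
    by_contra! h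
    have h1 : (Finset.univ.erase a).Nonempty := by
      rw [← Finset.card_pos, Finset.card_erase_of_mem (Finset.mem_univ _), Finset.card_univ]
      omega
    have := hT (Finset.univ.erase a) (Finset.subset_univ _) h1 (by
      intro x hx b _ hxb
      refine Finset.mem_erase.2 ⟨?_, Finset.mem_univ _⟩
      rintro rfl
      exact h x (Finset.mem_erase.1 hx).1 hxb)
    have h2 := Finset.mem_univ a
    rw [← this] at h2
    exact Finset.notMem_erase _ _ h2
  choose p hpne hpR using hp
  have hR : ∀ c a, G.Adj (u c) (w a) ↔ c = a ∨ c = p a := by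
    intro c a
    constructor
    · intro h
      by_cases hca : c = a
      · exact Or.inl hca
      · exact Or.inr (hin a c (p a) hca (hpne a) h (hpR a))
    · rintro (rfl | rfl)
      · exact hm _
      · exact hpR _
  have hcl : ∀ B : Finset ι, B.Nonempty → (∀ b ∈ B, p b ∈ B) → B = Finset.univ := by
    intro B ⟨b0, hb0⟩ hB
    by_contra hne
    have h1 : (Bᶜ).Nonempty := by
      rw [Finset.nonempty_iff_ne_empty]
      simpa using hne
    have := hT Bᶜ (Finset.subset_univ _) h1 (by
      intro a ha b _ hab
      rw [Finset.mem_compl] at ha ⊢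
      intro hb
      rcases (hR a b).1 hab with rfl | rfl
      · exact ha hb
      · exact ha (hB b hb))
    have h2 := Finset.mem_univ b0
    rw [← this, Finset.mem_compl] at h2
    exact h2 hb0
  have hne : Nonempty ι := by
    rw [← Fintype.card_pos_iff]; omega
  obtain ⟨a0⟩ := hne
  have hsurj : Function.Surjective p := by
    have := hcl (Finset.univ.image p) ⟨p a0, by simp⟩ (by simp)
    intro x
    have hx := Finset.mem_univ x
    rw [← this] at hx
    simpa using hx
  have hinj : Function.Injective p := Finite.injective_iff_surjective.2 hsurj
  have hper : a0 ∈ Function.periodicPts p := hinj.mem_periodicPts a0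
  have hpos := Function.minimalPeriod_pos_of_mem_periodicPts hper
  have hmod : ∀ k, p^[k % Function.minimalPeriod p a0] a0 = p^[k] a0 :=
    fun k => Function.iterate_mod_minimalPeriod_eq
  have hio : Set.InjOn (fun k => p^[k] a0) (Set.Iio (Function.minimalPeriod p a0)) :=
    Function.iterate_injOn_Iio_minimalPeriod
  have hzero : p^[Function.minimalPeriod p a0] a0 = a0 := Function.iterate_minimalPeriod
  have himg : (Finset.range (Function.minimalPeriod p a0)).image (fun k => p^[k] a0)
      = Finset.univ := by
    apply hcl
    · exact ⟨a0, by rw [Finset.mem_image]; exact ⟨0, Finset.mem_range.2 hpos, rfl⟩⟩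
    · intro b hb
      rw [Finset.mem_image] at hb ⊢
      obtain ⟨k, _, rfl⟩ := hb
      refine ⟨(k + 1) % _, Finset.mem_range.2 (Nat.mod_lt _ hpos), ?_⟩
      rw [hmod, Function.iterate_succ_apply']
  have hmp : Function.minimalPeriod p a0 = n := by
    have := congrArg Finset.card himg
    rw [Finset.card_image_of_injOn (by simpa using hio), Finset.card_range, Finset.card_univ] at this
    omega
  rw [hmp] at hio hzero
  set s : ℕ → ι := fun k => p^[k] a0 with hs
  have hss : ∀ k, p (s k) = s (k + 1) := fun k => (Function.iterate_succ_apply' p k a0).symm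
  have hsinj : ∀ k l, k < n → l < n → (s k = s l ↔ k = l) := by
    intro k l hk hl
    exact hio.eq_iff hk hl
  have hs0 : s n = s 0 := hzero
  have hadj : ∀ k l, k < n → l < n → (G.Adj (u (s k)) (w (s l)) ↔
      k = l ∨ k = l + 1 ∨ (k = 0 ∧ l + 1 = n)) := by
    intro k l hk hl
    rw [hR, hss, hsinj k l hk hl]
    rcases Nat.lt_or_ge (l + 1) n with h | h
    · rw [hsinj k (l + 1) hk h]; omega
    · have : l + 1 = n := by omega
      rw [this, hs0, hsinj k 0 hk (by omega)]; omega
  let f : Fin (2 * n) → V := fun m => if m.val % 2 = 0 then u (s (m.val / 2)) else w (s (m.val / 2))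
  have hf : ∀ m, f m = if m.val % 2 = 0 then u (s (m.val / 2)) else w (s (m.val / 2)) :=
    fun _ => rfl
  have hfinj : Function.Injective f := by
    intro m m' h
    have h1 := m.2
    have h2 := m'.2
    rw [hf, hf] at h
    apply Fin.ext
    split_ifs at h with h3 h4 h4
    · have := (hsinj _ _ (by omega) (by omega)).1 (hu h); omega
    · exact absurd h (huw _ _)
    · exact absurd h.symm (huw _ _)
    · have := (hsinj _ _ (by omega) (by omega)).1 (hw h); omega
  have hfadj : ∀ m m', G.Adj (f m) (f m') ↔ (cycleGraph (2 * n)).Adj m m' := by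
    intro m m'
    have h1 := m.2
    have h2 := m'.2
    rw [cyc_adj _ (by omega), hf, hf]
    split_ifs with h3 h4 h4
    · simp only [huu, false_iff]; omega
    · rw [hadj _ _ (by omega) (by omega)]; omega
    · rw [G.adj_comm, hadj _ _ (by omega) (by omega)]; omega
    · simp only [hww, false_iff]; omega
  refine ⟨Finset.univ.image f, ⟨RelIso.symm ⟨Equiv.ofBijective
    (fun m => (⟨f m, by simp⟩ : ((Finset.univ.image f : Finset V) : Set V))) ⟨?_, ?_⟩, ?_⟩⟩⟩
  · intro m m' h
    exact hfinj (congrArg Subtype.val h)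
  · rintro ⟨x, hx⟩
    simp only [Finset.coe_image, Finset.coe_univ, Set.image_univ, Set.mem_range] at hx
    obtain ⟨m, rfl⟩ := hx
    exact ⟨m, rfl⟩
  · intro m m'
    exact hfadj m m'

/-- Working form of an induced copy of a member of the family. -/
def HasF2 {V : Type*} [DecidableEq V] (q : ℕ) (G : SimpleGraph V) : Prop :=
  ∃ j : ℕ, ∃ A B : Finset V, 1 ≤ j ∧ j ≤ q ∧ Disjoint A B ∧ A.card = 2 * j + 2 ∧ B.card = q - j ∧
    (∀ b ∈ B, ∀ a ∈ A ∪ B, ¬ G.Adj b a) ∧ ElemBipartite (G.induce (A : Set V))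

lemma core {V ι : Type*} [DecidableEq V] [Fintype ι] [DecidableEq ι] (G : SimpleGraph V)
    (u w : ι → V) (hu : Function.Injective u) (hw : Function.Injective w)
    (huw : ∀ i j, u i ≠ w j) (huu : ∀ i j, ¬ G.Adj (u i) (u j))
    (hww : ∀ i j, ¬ G.Adj (w i) (w j)) (hm : ∀ i, G.Adj (u i) (w i))
    (hT : Strong (fun i j => G.Adj (u i) (w j)) Finset.univ)
    (q : ℕ) (hn : Fintype.card ι = q + 2) :
    HasF2 q G ∨ ∃ S : Finset V, Nonempty (G.induce (S : Set V) ≃g cycleGraph (2 * (q + 2))) := by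
  classical
  set R : ι → ι → Prop := fun i j => G.Adj (u i) (w j) with hRdef
  by_cases hex : ∃ T : Finset ι, Strong R T ∧ T ≠ Finset.univ ∧ 2 ≤ T.card
  · left
    obtain ⟨T0, hT0⟩ := hex
    obtain ⟨T, hTm, hTmax⟩ := Finset.exists_max_image
      (Finset.univ.filter fun T : Finset ι => Strong R T ∧ T ≠ Finset.univ ∧ 2 ≤ T.card)
      Finset.card ⟨T0, by simpa using hT0⟩
    simp only [Finset.mem_filter, Finset.mem_univ, true_and] at hTm hTmax
    obtain ⟨hTs, hTu, hT2⟩ := hTm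
    have hne : T.Nonempty := Finset.card_pos.1 (by omega)
    have hmax : ∀ S, T ⊂ S → Strong R S → S = Finset.univ := by
      intro S hTS hS
      by_contra hSu
      have h1 := Finset.card_lt_card hTS
      have := hTmax S ⟨hS, hSu, by omega⟩
      omega
    have hTlt : T.card < q + 2 := by
      obtain ⟨x, hx⟩ : ∃ x, x ∉ T := by
        by_contra! h
        exact hTu (Finset.eq_univ_iff_forall.2 h)
      rw [← hn]
      exact Finset.card_lt_univ_of_notMem hx
    set X := Tᶜ.filter (fun c => ∃ t ∈ T, R c t) with hX
    have hXc : X.card ≤ 1 := by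
      rw [Finset.card_le_one]
      intro a ha b hb
      simp only [hX, Finset.mem_filter, Finset.mem_compl] at ha hb
      obtain ⟨ha, t, ht, hat⟩ := ha
      obtain ⟨hb, t', ht', hbt⟩ := hb
      exact strong_unique R hT T hTs hne hmax a b ha hb t ht hat t' ht' hbt
    have hYc : q + 1 - T.card ≤ (Tᶜ \ X).card := by
      have := Finset.le_card_sdiff X Tᶜ
      rw [Finset.card_compl, hn] at this
      omega
    obtain ⟨Y, hY, hYcard⟩ := Finset.exists_subset_card_eq hYc
    have hY' : ∀ y ∈ Y, y ∉ T ∧ ∀ t ∈ T, ¬ R y t := by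
      intro y hy
      have := hY hy
      simp only [hX, Finset.mem_sdiff, Finset.mem_filter, Finset.mem_compl] at this
      exact ⟨this.1, fun t ht h => this.2 ⟨this.1, t, ht, h⟩⟩
    refine ⟨T.card - 1, T.image u ∪ T.image w, Y.image u, by omega, by omega, ?_, ?_, ?_, ?_, 
      elem_of_strong G u w hu hw huw huu hww hm T hTs⟩
    · rw [Finset.disjoint_right]
      intro x hx hx'
      rw [Finset.mem_image] at hx
      obtain ⟨y, hy, rfl⟩ := hx
      simp only [Finset.mem_union, Finset.mem_image] at hx'
      rcases hx' with ⟨t, ht, h⟩ | ⟨t, ht, h⟩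
      · exact (hY' y hy).1 (hu h ▸ ht)
      · exact huw _ _ h.symm
    · rw [Finset.card_union_of_disjoint, Finset.card_image_of_injective _ hu,
        Finset.card_image_of_injective _ hw]
      · omega
      · rw [Finset.disjoint_left]
        intro x hx hx'
        rw [Finset.mem_image] at hx hx'
        obtain ⟨y, hy, rfl⟩ := hx
        obtain ⟨z, hz, h⟩ := hx'
        exact huw _ _ h.symm
    · rw [Finset.card_image_of_injective _ hu, hYcard]; omega
    · intro b hb a ha
      rw [Finset.mem_image] at hb
      obtain ⟨y, hy, rfl⟩ := hb
      simp only [Finset.mem_union, Finset.mem_image] at ha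
      rcases ha with (⟨t, ht, rfl⟩ | ⟨t, ht, rfl⟩) | ⟨t, ht, rfl⟩
      · exact huu _ _
      · exact (hY' y hy).2 t ht
      · exact huu _ _
  · right
    push Not at hex
    refine cycle_case G u w hu hw huw huu hww hm hT (q + 2) hn (by omega) ?_
    intro a c c' hca hca' h h'
    refine strong_unique R hT {a} (strong_singleton R a) ⟨a, by simp⟩ ?_ c c' (by simpa using hca)
      (by simpa using hca') a (by simp) h a (by simp) h'
    intro S haS hS
    by_contra hSu
    have h1 := hex S hS hSu
    have h2 := Finset.card_lt_card haS
    rw [Finset.card_singleton] at h2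
    omega

lemma match_fun {V : Type*} (H : SimpleGraph V) (U W : Set V) (hd : Disjoint U W)
    (hb : ∀ a b, H.Adj a b → (a ∈ U ∧ b ∈ W) ∨ (a ∈ W ∧ b ∈ U)) (u w : V)
    (hw : w ∈ W)
    (M : H.Subgraph) (hv : M.verts = Set.univ \ {u, w}) (hM : M.IsMatching) :
    ∃ f : V → V, (∀ x ∈ U, x ≠ u → f x ∈ W ∧ f x ≠ w ∧ H.Adj x (f x)) ∧
      Set.InjOn f (U \ {u}) := by
  classical
  have h : ∀ x, ∃ y, x ∈ U → x ≠ u → M.Adj x y := by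
    intro x
    by_cases hx : x ∈ U ∧ x ≠ u
    · have : x ∈ M.verts := by
        rw [hv]
        simp only [Set.mem_sdiff, Set.mem_univ, Set.mem_insert_iff, Set.mem_singleton_iff, true_and,
          not_or]
        exact ⟨hx.2, fun h => Set.disjoint_left.1 hd hx.1 (h ▸ hw)⟩
      obtain ⟨y, hy, _⟩ := hM this
      exact ⟨y, fun _ _ => hy⟩
    · exact ⟨x, fun h1 h2 => absurd ⟨h1, h2⟩ hx⟩
  choose f hf using h
  refine ⟨f, ?_, ?_⟩
  · intro x hx hxu
    have h1 := hf x hx hxu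
    have h2 : f x ∈ M.verts := M.edge_vert h1.symm
    rw [hv] at h2
    simp only [Set.mem_sdiff, Set.mem_univ, Set.mem_insert_iff, Set.mem_singleton_iff, true_and,
          not_or] at h2
    refine ⟨?_, h2.2, h1.adj_sub⟩
    rcases hb _ _ h1.adj_sub with h | h
    · exact h.2
    · exact absurd h.1 (Set.disjoint_left.1 hd hx)
  · intro x hx y hy hxy
    have h1 := hf x hx.1 hx.2
    have h2 := hf y hy.1 hy.2
    rw [← hxy] at h2
    obtain ⟨z, _, hz⟩ := hM (M.edge_vert h1.symm)
    rw [hz x h1.symm, hz y h2.symm]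

lemma elem_data {V : Type*} [Fintype V] (H : SimpleGraph V) (n : ℕ) (hn : 2 ≤ n)
    (hcard : Fintype.card V = 2 * n) (U W : Set V) (hd : Disjoint U W)
    (hun : U ∪ W = Set.univ)
    (hb : ∀ a b, H.Adj a b → (a ∈ U ∧ b ∈ W) ∨ (a ∈ W ∧ b ∈ U))
    (hM : ∀ u ∈ U, ∀ w ∈ W, ∃ M : H.Subgraph, M.verts = Set.univ \ {u, w} ∧ M.IsMatching)
    (hU : U.Nonempty) (hW : W.Nonempty) :
    ∃ u w : Fin n → V, Function.Injective u ∧ Function.Injective w ∧ (∀ i j, u i ≠ w j) ∧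
      (∀ i j, ¬ H.Adj (u i) (u j)) ∧ (∀ i j, ¬ H.Adj (w i) (w j)) ∧ (∀ i, H.Adj (u i) (w i)) ∧
      Strong (fun i j => H.Adj (u i) (w j)) Finset.univ := by
  classical
  have hF : ∀ u ∈ U, ∀ w ∈ W, ∃ f : V → V,
      (∀ x ∈ U, x ≠ u → f x ∈ W ∧ f x ≠ w ∧ H.Adj x (f x)) ∧ Set.InjOn f (U \ {u}) := by
    intro u hu w hw
    obtain ⟨M, hv, hMM⟩ := hM u hu w hw
    exact match_fun H U W hd hb u w hw M hv hMM
  have hF' : ∀ u ∈ U, ∀ w ∈ W, ∃ f : V → V,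
      (∀ x ∈ W, x ≠ w → f x ∈ U ∧ f x ≠ u ∧ H.Adj x (f x)) ∧ Set.InjOn f (W \ {w}) := by
    intro u hu w hw
    obtain ⟨M, hv, hMM⟩ := hM u hu w hw
    rw [Set.pair_comm] at hv
    exact match_fun H W U hd.symm (fun a b h => (hb a b h).symm) w u hu M hv hMM
  obtain ⟨u0, hu0⟩ := hU
  obtain ⟨w0, hw0⟩ := hW
  have hsum : U.ncard + W.ncard = 2 * n := by
    rw [← Set.ncard_union_eq hd, hun, Set.ncard_univ, Nat.card_eq_fintype_card, hcard]
  have hUpos : 0 < U.ncard := (Set.ncard_pos).2 ⟨u0, hu0⟩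
  have hWpos : 0 < W.ncard := (Set.ncard_pos).2 ⟨w0, hw0⟩
  have hUW : U.ncard = n ∧ W.ncard = n := by
    obtain ⟨f, hf, hfi⟩ := hF u0 hu0 w0 hw0
    obtain ⟨g, hg, hgi⟩ := hF' u0 hu0 w0 hw0
    have h1 := Set.ncard_le_ncard_of_injOn (s := U \ {u0}) (t := W \ {w0}) f
      (fun x hx => ⟨(hf x hx.1 hx.2).1, (hf x hx.1 hx.2).2.1⟩) hfi
    have h2 := Set.ncard_le_ncard_of_injOn (s := W \ {w0}) (t := U \ {u0}) g
      (fun x hx => ⟨(hg x hx.1 hx.2).1, (hg x hx.1 hx.2).2.1⟩) hgi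
    rw [Set.ncard_sdiff_singleton_of_mem hu0, Set.ncard_sdiff_singleton_of_mem hw0] at h1 h2
    omega
  obtain ⟨hUn, hWn⟩ := hUW
  obtain ⟨x, hx, hxu0⟩ : ∃ x ∈ U, x ≠ u0 := Set.exists_ne_of_one_lt_ncard (by omega) u0
  obtain ⟨y, hy, hxy⟩ : ∃ y ∈ W, H.Adj x y := by
    obtain ⟨f, hf, hfi⟩ := hF u0 hu0 w0 hw0
    exact ⟨f x, (hf x hx hxu0).1, (hf x hx hxu0).2.2⟩
  obtain ⟨f, hf, hfi⟩ := hF x hx y hy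
  let μ : V → V := fun z => if z = x then y else f z
  have hμ : ∀ z ∈ U, μ z ∈ W ∧ H.Adj z (μ z) := by
    intro z hz
    by_cases h : z = x
    · subst h; simpa [μ] using ⟨hy, hxy⟩
    · simpa [μ, h] using ⟨(hf z hz h).1, (hf z hz h).2.2⟩
  have hμi : Set.InjOn μ U := by
    intro a ha b hb hab
    by_cases h : a = x <;> by_cases h' : b = x
    · rw [h, h']
    · simp only [μ, h, h', if_true, if_false] at hab
      exact absurd hab.symm (hf b hb h').2.1
    · simp only [μ, h, h', if_true, if_false] at hab
      exact absurd hab (hf a ha h).2.1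
    · simp only [μ, h, h', if_false] at hab
      exact hfi ⟨ha, h⟩ ⟨hb, h'⟩ hab
  have hcU : Nat.card U = n := by rw [Nat.card_coe_set_eq, hUn]
  let e : Fin n ≃ U := (Finite.equivFinOfCardEq hcU).symm
  let u : Fin n → V := fun i => (e i).1
  let w : Fin n → V := fun i => μ (e i).1
  have huU : ∀ i, u i ∈ U := fun i => (e i).2
  have hwW : ∀ i, w i ∈ W := fun i => (hμ _ (e i).2).1
  have hui : Function.Injective u := Subtype.val_injective.comp e.injective
  have hwi : Function.Injective w := by
    intro i j h
    exact hui (hμi (e i).2 (e j).2 h)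
  have hwr : Set.range w = W := by
    apply Set.eq_of_subset_of_ncard_le
    · rintro _ ⟨i, rfl⟩; exact hwW i
    · rw [hWn, ← Set.image_univ, Set.ncard_image_of_injective _ hwi, Set.ncard_univ]
      simp
    · exact Set.toFinite W
  refine ⟨u, w, hui, hwi, ?_, ?_, ?_, fun i => (hμ _ (e i).2).2, ?_⟩
  · intro i j h
    exact Set.disjoint_left.1 hd (huU i) (h ▸ hwW j)
  · intro i j h
    rcases hb _ _ h with h | h
    · exact Set.disjoint_left.1 hd (huU j) h.2
    · exact Set.disjoint_left.1 hd (huU i) h.1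
  · intro i j h
    rcases hb _ _ h with h | h
    · exact Set.disjoint_left.1 hd h.1 (hwW i)
    · exact Set.disjoint_left.1 hd h.2 (hwW j)
  · intro A _ ⟨a, ha⟩ hcl
    by_contra hne
    obtain ⟨i0, hi0⟩ : ∃ i, i ∉ A := by
      by_contra! h
      exact hne (Finset.eq_univ_iff_forall.2 h)
    obtain ⟨F, hFp, hFi⟩ := hF (u i0) (huU i0) (w a) (hwW a)
    have hk : ∀ i, ∃ k, i ∈ A → w k = F (u i) := by
      intro i
      by_cases hi : i ∈ A
      · have := (hFp (u i) (huU i) (fun h => hi0 (hui h ▸ hi))).1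
        rw [← hwr] at this
        obtain ⟨k, hk⟩ := this
        exact ⟨k, fun _ => hk⟩
      · exact ⟨i, fun h => absurd h hi⟩
    choose g hg using hk
    have hne' : ∀ i ∈ A, u i ≠ u i0 := fun i hi h => hi0 (hui h ▸ hi)
    have h1 : A.card ≤ (A.erase a).card := by
      apply Finset.card_le_card_of_injOn g
      · intro i hi
        have h2 := hFp (u i) (huU i) (hne' i hi)
        rw [← hg i hi] at h2
        rw [Finset.mem_coe, Finset.mem_erase]
        exact ⟨fun h => h2.2.1 (h ▸ rfl), hcl i hi _ (Finset.mem_univ _) h2.2.2⟩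
      · intro i hi j hj hij
        apply hui
        apply hFi ⟨huU i, hne' i hi⟩ ⟨huU j, hne' j hj⟩
        rw [← hg i hi, ← hg j hj, hij]
    have := Finset.card_erase_lt_of_mem ha
    omega

lemma elem_iso {X Y : Type*} (H : SimpleGraph X) (K : SimpleGraph Y) (e : H ≃g K)
    (h : ElemBipartite H) : ElemBipartite K := by
  obtain ⟨U, W, hd, hun, hb, hM⟩ := h
  refine ⟨e.symm ⁻¹' U, e.symm ⁻¹' W, hd.preimage _, ?_, ?_, ?_⟩
  · rw [← Set.preimage_union, hun, Set.preimage_univ]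
  · intro a b hab
    exact hb _ _ (e.symm.map_adj_iff.2 hab)
  · intro u hu w hw
    obtain ⟨M, hv, hMM⟩ := hM _ hu _ hw
    refine ⟨M.map e.toHom, ?_, hMM.map e.toHom e.injective⟩
    ext y
    rw [SimpleGraph.Subgraph.map_verts, hv]
    constructor
    · rintro ⟨x, hx, rfl⟩
      simp only [Set.mem_sdiff, Set.mem_univ, Set.mem_insert_iff, Set.mem_singleton_iff, true_and,
          not_or] at hx ⊢
      exact ⟨fun h => hx.1 (by rw [← h]; exact (e.symm_apply_apply x).symm),
        fun h => hx.2 (by rw [← h]; exact (e.symm_apply_apply x).symm)⟩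
    · intro hy
      simp only [Set.mem_sdiff, Set.mem_univ, Set.mem_insert_iff, Set.mem_singleton_iff, true_and,
          not_or] at hy
      refine ⟨e.symm y, ?_, e.apply_symm_apply y⟩
      simp only [Set.mem_sdiff, Set.mem_univ, Set.mem_insert_iff, Set.mem_singleton_iff, true_and,
          not_or, EmbeddingLike.apply_eq_iff_eq]
      exact hy

/-- Nested induced subgraphs. -/
def nestIso {V : Type*} (G : SimpleGraph V) (S A : Set V) (hA : A ⊆ S) (S' : Set S)
    (h : ∀ x : S, x ∈ S' ↔ x.1 ∈ A) :
    (G.induce S).induce S' ≃g G.induce A where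
  toFun x := ⟨x.1.1, (h _).1 x.2⟩
  invFun x := ⟨⟨x.1, hA x.2⟩, (h _).2 x.2⟩
  left_inv _ := rfl
  right_inv _ := rfl
  map_rel_iff' := Iff.rfl

lemma memF2_out {V : Type*} [DecidableEq V] (q : ℕ) (G : SimpleGraph V) (S : Finset V)
    (h : MemF2 q (G.induce (S : Set V))) : HasF2 q G := by
  obtain ⟨j, h1, h2, S', hc, hS, hadj, hE⟩ := h
  have hsub : S'.map (Function.Embedding.subtype _) ⊆ S := by
    intro x hx
    simp only [Finset.mem_map, Function.Embedding.subtype_apply] at hx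
    obtain ⟨y, _, rfl⟩ := hx
    exact y.2
  refine ⟨j, S'.map (Function.Embedding.subtype _), S \ S'.map (Function.Embedding.subtype _),
    h1, h2, Finset.disjoint_sdiff, by rw [Finset.card_map, hc], ?_, ?_, ?_⟩
  · rw [Finset.card_sdiff_of_subset hsub, Finset.card_map, hc]
    simp only [Finset.coe_sort_coe, Fintype.card_coe] at hS
    omega
  · intro b hb a ha hba
    rw [Finset.union_sdiff_of_subset hsub] at ha
    rw [Finset.mem_sdiff] at hb
    apply hb.2
    have := (hadj ⟨b, hb.1⟩ ⟨a, ha⟩ hba).1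
    rw [Finset.mem_map]
    exact ⟨_, this, rfl⟩
  · refine elem_iso _ _ (nestIso G _ _ (by exact_mod_cast hsub) _ ?_) hE
    intro x
    simp

lemma memF2_in {V : Type*} [DecidableEq V] (q : ℕ) (G : SimpleGraph V)
    (h : HasF2 q G) : ∃ S : Finset V, MemF2 q (G.induce (S : Set V)) := by
  obtain ⟨j, A, B, h1, h2, hd, hA, hB, hadj, hE⟩ := h
  refine ⟨A ∪ B, j, h1, h2, Finset.univ.filter (fun x => x.1 ∈ A), ?_, ?_, ?_, ?_⟩
  · rw [← hA]
    rw [← Finset.card_map (Function.Embedding.subtype _)]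
    congr 1
    ext x
    simp only [Finset.mem_map, Finset.mem_filter, Finset.mem_univ, true_and,
      Function.Embedding.subtype_apply]
    constructor
    · rintro ⟨y, hy, rfl⟩; exact hy
    · intro hx; exact ⟨⟨x, by simp [hx]⟩, hx, rfl⟩
  · simp only [Finset.coe_sort_coe, Fintype.card_coe]
    rw [Finset.card_union_of_disjoint hd, hA, hB]
  · have key : ∀ a b : ((A ∪ B : Finset V) : Set V), G.Adj a.1 b.1 → a.1 ∈ A := by
      intro a b hab
      by_contra haA
      have ha := a.2
      rw [Finset.mem_coe, Finset.mem_union] at ha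
      exact hadj _ (ha.resolve_left haA) _ b.2 hab
    intro a b hab
    simp only [Finset.mem_filter, Finset.mem_univ, true_and]
    exact ⟨key a b hab, key b a hab.symm⟩
  · refine elem_iso _ _ (nestIso G _ _ (by simp) _ ?_).symm hE
    intro x
    simp

lemma edgeless_case {V : Type*} [DecidableEq V] (q : ℕ) (hq : 1 ≤ q) (G : SimpleGraph V)
    (A : Finset V) (hA : q + 3 ≤ A.card) (h : ∀ a ∈ A, ∀ b ∈ A, ¬ G.Adj a b) : HasF2 q G := by
  obtain ⟨A1, hA1, hc1⟩ := Finset.exists_subset_card_eq (show 4 ≤ A.card by omega)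
  have h3 : q - 1 ≤ (A \ A1).card := by
    rw [Finset.card_sdiff_of_subset hA1]; omega
  obtain ⟨B, hB, hcB⟩ := Finset.exists_subset_card_eq h3
  have hBA : B ⊆ A := hB.trans Finset.sdiff_subset
  refine ⟨1, A1, B, le_rfl, hq, ?_, hc1, hcB, ?_, ?_⟩
  · exact Finset.disjoint_of_subset_right hB Finset.disjoint_sdiff
  · intro b hb a ha
    exact h b (hBA hb) a ((Finset.union_subset hA1 hBA) ha)
  · refine ⟨∅, Set.univ, by simp, by simp, ?_, by simp⟩
    intro a b hab
    exact absurd hab (h _ (hA1 a.2) _ (hA1 b.2))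

/-- if `G` is `𝓕_{q,2}`-free and `C_{2q+4}`-free, then `G` is
`𝓕_{q+1,2}`-free. -/
theorem f2Free_succ {V : Type*} [Fintype V] [DecidableEq V]
    (q : ℕ) (hq : 1 ≤ q) (G : SimpleGraph V)
    (h2 : F2Free q G) (hC : CycleFree G (2 * q + 4)) :
    F2Free (q + 1) G := by
  intro S hS
  have hno : ¬ HasF2 q G := fun h => by
    obtain ⟨S, hS⟩ := memF2_in q G h
    exact h2 S hS
  obtain ⟨j, A, B, h1, hj, hd, hA, hB, hadj, hE⟩ := memF2_out _ _ _ hS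
  rcases Nat.lt_or_ge q j with hjq | hjq
  · have hj' : j = q + 1 := by omega
    subst hj'
    obtain ⟨U, W, hdUW, hun, hb, hM⟩ := hE
    rcases U.eq_empty_or_nonempty with hU | hU
    · refine hno (edgeless_case q hq G A (by omega) ?_)
      intro a ha b hb' hab
      rcases hb ⟨a, ha⟩ ⟨b, hb'⟩ hab with h | h
      · rw [hU] at h; exact h.1
      · rw [hU] at h; exact h.2
    rcases W.eq_empty_or_nonempty with hW | hW
    · refine hno (edgeless_case q hq G A (by omega) ?_)
      intro a ha b hb' hab
      rcases hb ⟨a, ha⟩ ⟨b, hb'⟩ hab with h | h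
      · rw [hW] at h; exact h.2
      · rw [hW] at h; exact h.1
    obtain ⟨u, w, hu, hw, huw, huu, hww, hm, hT⟩ := elem_data (G.induce (A : Set V)) (q + 2)
      (by omega) (by simp only [Finset.coe_sort_coe, Fintype.card_coe]; omega)
      U W hdUW hun hb hM hU hW
    rcases core G (fun i => (u i).1) (fun i => (w i).1) (Subtype.val_injective.comp hu)
      (Subtype.val_injective.comp hw) (fun i j h => huw i j (Subtype.ext h)) huu hww hm hT q
      (by simp) with h | ⟨S, ⟨e⟩⟩
    · exact hno h
    · exact (hC S).false e
  · have hne : B.Nonempty := Finset.card_pos.1 (by omega)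
    obtain ⟨b, hbB⟩ := hne
    refine hno ⟨j, A, B.erase b, h1, hjq, ?_, hA, ?_, ?_, hE⟩
    · exact Finset.disjoint_of_subset_right (Finset.erase_subset _ _) hd
    · rw [Finset.card_erase_of_mem hbB, hB]; omega
    · intro x hx a ha
      exact hadj x (Finset.mem_of_mem_erase hx) a
        (Finset.union_subset_union_right (Finset.erase_subset _ _) ha)
end

section
/- Let q ≥ 1 and let T be a tree with matching number ν(T) ≥ q. If T has at least 2q+2 vertices, then there exists a matching M of size q in T such that the set V(T) ∖ V(M) of vertices not covered by M contains two distinct leaves of T. -/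
open SimpleGraph Finset

/-- matching as an involution -/
structure TMInv {V : Type*} (T : SimpleGraph V) (f : V → V) : Prop where
  inv : ∀ v, f (f v) = v
  adj : ∀ v, f v ≠ v → T.Adj v (f v)

lemma tm_closer_unique {V : Type*} {T : SimpleGraph V} (hT : T.IsTree) {v u a b : V}
    (ha : T.Adj u a) (hb : T.Adj u b) (hda : T.dist v u = T.dist v a + 1)
    (hdb : T.dist v u = T.dist v b + 1) : a = b := by
  obtain ⟨p, hp⟩ := hT.connected.exists_walk_length_eq_dist v a
  obtain ⟨r, hr⟩ := hT.connected.exists_walk_length_eq_dist v b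
  have h1 : (p.concat ha.symm).IsPath :=
    Walk.isPath_of_length_eq_dist _ (by rw [Walk.length_concat]; omega)
  have h2 : (r.concat hb.symm).IsPath :=
    Walk.isPath_of_length_eq_dist _ (by rw [Walk.length_concat]; omega)
  have h3 := (hT.existsUnique_path v u).unique h1 h2
  have h4 := congrArg Walk.penultimate h3
  simpa using h4

lemma tm_farther {V : Type*} [Fintype V] {T : SimpleGraph V} [DecidableRel T.Adj]
    (hT : T.IsTree) {v u : V} (huv : u ≠ v) (hd : T.degree u ≠ 1) :
    ∃ w, T.Adj u w ∧ T.dist v w = T.dist v u + 1 := by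
  by_contra! hcon
  apply hd
  have key : ∀ a, T.Adj u a → T.dist v u = T.dist v a + 1 := fun a ha =>
    (hT.dist_eq_dist_add_one_of_adj v ha).resolve_right (hcon a ha)
  haveI : Nontrivial V := ⟨u, v, huv⟩
  obtain ⟨a, ha⟩ := hT.connected.preconnected.exists_adj_of_nontrivial u
  rw [← T.card_neighborFinset_eq_degree, Finset.card_eq_one]
  refine ⟨a, ?_⟩
  ext b
  simp only [mem_neighborFinset, Finset.mem_singleton]
  exact ⟨fun hb => tm_closer_unique hT hb ha (key b hb) (key a ha), fun h => h ▸ ha⟩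

lemma tm_step {V : Type*} [Fintype V] [DecidableEq V] {T : SimpleGraph V} [DecidableRel T.Adj]
    (hT : T.IsTree) {f : V → V} (hf : TMInv T f) {u v : V} (huv : u ≠ v)
    (hu : f u = u) (hv : f v = v) (hd : T.degree u ≠ 1) :
    ∃ f' : V → V, ∃ u', TMInv T f' ∧ u' ≠ v ∧ f' u' = u' ∧ f' v = v ∧
      (univ.filter fun x => f' x ≠ x).card = (univ.filter fun x => f x ≠ x).card ∧
      T.dist u v < T.dist u' v := by
  obtain ⟨w, hw, hdw⟩ := tm_farther hT huv hd
  have hwv : w ≠ v := by rintro rfl; simp at hdw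
  have hc1 := T.dist_comm (u := u) (v := v)
  by_cases hfw : f w = w
  · refine ⟨f, w, hf, hwv, hfw, hv, rfl, ?_⟩
    rw [T.dist_comm (u := w)]; omega
  · have hwx := hf.adj w hfw
    set x := f w with hx
    have hfx : f x = w := hf.inv w
    have hxu : x ≠ u := by
      intro h; apply hw.ne; rw [← hfx, h, hu]
    have hdx : T.dist v x = T.dist v w + 1 := by
      refine (hT.dist_eq_dist_add_one_of_adj v hwx).resolve_left fun h => ?_
      exact hxu (tm_closer_unique hT hwx hw.symm h hdw)
    have hxv : x ≠ v := by rintro h; rw [h] at hdx; simp at hdx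
    let s := Equiv.swap u x
    have hss : ∀ y, s (s y) = y := fun y => Equiv.swap_apply_self u x y
    have hsu : s u = x := Equiv.swap_apply_left _ _
    have hsx : s x = u := Equiv.swap_apply_right _ _
    have hso : ∀ y, y ≠ u → y ≠ x → s y = y := fun y h1 h2 => Equiv.swap_apply_of_ne_of_ne h1 h2
    have hwu : w ≠ u := hw.ne'
    have hwx' : w ≠ x := hwx.ne
    refine ⟨fun y => s (f (s y)), x, ⟨fun y => ?_, fun y hy => ?_⟩, hxv, ?_, ?_, ?_, ?_⟩
    · simp [hss, hf.inv]
    · change T.Adj y (s (f (s y)))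
      by_cases h1 : y = u
      · rw [h1, hsu, hfx, hso w hwu hwx']; exact hw
      by_cases h2 : y = x
      · exfalso; apply hy; change s (f (s y)) = y; rw [h2, hsx, hu, hsu]
      by_cases h3 : y = w
      · rw [h3, hso w hwu hwx', ← hx, hsx]; exact hw.symm
      · have h4 : f y ≠ u := fun h => h1 (by rw [← hf.inv y, h, hu])
        have h5 : f y ≠ x := fun h => h3 (by rw [← hf.inv y, h, hfx])
        rw [hso y h1 h2, hso _ h4 h5]
        apply hf.adj
        intro h; apply hy
        change s (f (s y)) = y
        rw [hso y h1 h2, hso _ h4 h5, h]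
    · change s (f (s x)) = x
      rw [hsx, hu, hsu]
    · change s (f (s v)) = v
      rw [hso v huv.symm hxv.symm, hv, hso v huv.symm hxv.symm]
    · apply Finset.card_bij (fun y _ => s y)
      · intro y hy
        simp only [Finset.mem_filter, Finset.mem_univ, true_and] at hy ⊢
        intro h; apply hy; rw [h, hss]
      · intro a _ b _ h; exact s.injective h
      · intro y hy
        simp only [Finset.mem_filter, Finset.mem_univ, true_and] at hy ⊢
        refine ⟨s y, ?_, hss y⟩
        rw [hss]
        exact fun h => hy (s.injective h)
    · rw [T.dist_comm (u := x)]; omega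

lemma tm_shrink {V : Type*} [Fintype V] [DecidableEq V] {T : SimpleGraph V} (q : ℕ) :
    ∀ n : ℕ, ∀ f : V → V, TMInv T f → (univ.filter fun x => f x ≠ x).card = 2 * q + 2 * n →
    ∃ f' : V → V, TMInv T f' ∧ (univ.filter fun x => f' x ≠ x).card = 2 * q := by
  intro n
  induction n with
  | zero => intro f hf h; exact ⟨f, hf, h⟩
  | succ n ih =>
    intro f hf h
    obtain ⟨a, ha⟩ : (univ.filter fun x => f x ≠ x).Nonempty := by
      rw [← Finset.card_pos]; omega
    have ha' : f a ≠ a := by simpa using ha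
    have hb : f a ∈ (univ.filter fun x => f x ≠ x).erase a := by
      simp [ha', hf.inv, ha'.symm]
    have hfi := hf.inv
    apply ih (fun y => if y = a ∨ y = f a then y else f y)
    · refine ⟨fun y => ?_, fun y hy => ?_⟩
      · grind
      · have := hf.adj y
        grind
    · have h2 : (univ.filter fun x => (if x = a ∨ x = f a then x else f x) ≠ x)
          = ((univ.filter fun x => f x ≠ x).erase a).erase (f a) := by
        ext y; simp only [Finset.mem_filter, Finset.mem_univ, Finset.mem_erase]; grind
      rw [h2, Finset.card_erase_of_mem hb, Finset.card_erase_of_mem ha, h]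
      omega

lemma tm_of_sub {V : Type*} [Fintype V] [DecidableEq V] {T : SimpleGraph V} (M : T.Subgraph)
    (hM : M.IsMatching) : ∃ f : V → V, TMInv T f ∧ ∀ v, f v ≠ v ↔ v ∈ M.verts := by
  classical
  have h : ∀ v, ∃ w, (v ∈ M.verts → M.Adj v w) ∧ (v ∉ M.verts → w = v) := by
    intro v
    by_cases hv : v ∈ M.verts
    · obtain ⟨w, hw, _⟩ := hM hv
      exact ⟨w, fun _ => hw, fun h => absurd hv h⟩
    · exact ⟨v, fun h => absurd h hv, fun _ => rfl⟩
  choose f h1 h2 using h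
  refine ⟨f, ⟨fun v => ?_, fun v hv => ?_⟩, fun v => ⟨fun h => ?_, fun h => ?_⟩⟩
  · by_cases hv : v ∈ M.verts
    · have h3 := h1 v hv
      have h4 : f v ∈ M.verts := M.edge_vert h3.symm
      exact (hM h4).unique (h1 _ h4) h3.symm
    · rw [h2 v hv, h2 v hv]
  · by_cases hv' : v ∈ M.verts
    · exact (h1 v hv').adj_sub
    · exact absurd (h2 v hv') hv
  · by_contra hv; exact h (h2 v hv)
  · exact (h1 v h).adj_sub.ne'

def tmSub {V : Type*} {T : SimpleGraph V} (f : V → V) (hf : TMInv T f) : T.Subgraph where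
  verts := {v | f v ≠ v}
  Adj a b := f a = b ∧ a ≠ b
  adj_sub := by
    rintro a b ⟨rfl, h⟩; exact hf.adj a h.symm
  edge_vert := by
    rintro a b ⟨rfl, h⟩; exact h.symm
  symm := ⟨by
    rintro a b ⟨rfl, h⟩; exact ⟨hf.inv a, h.symm⟩⟩

lemma tmSub_isMatching {V : Type*} {T : SimpleGraph V} (f : V → V) (hf : TMInv T f) :
    (tmSub f hf).IsMatching := by
  intro v hv
  exact ⟨f v, ⟨rfl, Ne.symm hv⟩, fun w hw => hw.1.symm⟩

/-- a tree on at least `2q+2` vertices with matching number `≥ q` has a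
matching of size `q` avoiding two distinct leaves. -/
theorem tree_matching_avoiding_two_leaves {V : Type*} [Fintype V] [DecidableEq V]
    (q : ℕ) (hq : 1 ≤ q) (T : SimpleGraph V) [DecidableRel T.Adj] (hT : T.IsTree)
    (hν : ∃ M : T.Subgraph, M.IsMatching ∧ 2 * q ≤ M.verts.ncard)
    (hcard : 2 * q + 2 ≤ Fintype.card V) :
    ∃ M : T.Subgraph, M.IsMatching ∧ M.verts.ncard = 2 * q ∧
      ∃ l₁ l₂ : V, l₁ ≠ l₂ ∧ l₁ ∉ M.verts ∧ l₂ ∉ M.verts ∧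
        T.degree l₁ = 1 ∧ T.degree l₂ = 1 := by
  classical
  obtain ⟨M₀, hM₀, hc₀⟩ := hν
  obtain ⟨f₀, hf₀, hs₀⟩ := tm_of_sub M₀ hM₀
  have hcard₀ : (univ.filter fun x => f₀ x ≠ x).card = M₀.verts.ncard := by
    rw [Set.ncard_eq_toFinset_card']
    congr 1; ext x
    rw [Finset.mem_filter, Set.mem_toFinset, hs₀]
    simp
  have hev : Even M₀.verts.ncard := by
    rw [Set.ncard_eq_toFinset_card']; exact hM₀.even_card
  obtain ⟨m, hm⟩ := hev
  obtain ⟨f₁, hf₁, hc₁⟩ := tm_shrink (T := T) q (m - q) f₀ hf₀ (by omega)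
  let P : ℕ → Prop := fun d => ∃ f : V → V, ∃ u v, TMInv T f ∧ u ≠ v ∧ f u = u ∧ f v = v ∧
    (univ.filter fun x => f x ≠ x).card = 2 * q ∧ T.dist u v = d
  have hP : ∃ d, P d := by
    have h1 := Finset.card_filter_add_card_filter_not (s := (univ : Finset V)) (fun x => f₁ x ≠ x)
    rw [Finset.card_univ] at h1
    obtain ⟨u, hu, v, hv, huv⟩ : ∃ u ∈ univ.filter (fun x => ¬ f₁ x ≠ x),
        ∃ v ∈ univ.filter (fun x => ¬ f₁ x ≠ x), u ≠ v :=
      Finset.one_lt_card.mp (by omega)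
    exact ⟨_, f₁, u, v, hf₁, huv, by simpa using hu, by simpa using hv, hc₁, rfl⟩
  have hbd : ∀ d, P d → d ≤ Fintype.card V := by
    rintro d ⟨f, u, v, -, -, -, -, -, rfl⟩
    obtain ⟨p, hp, hl⟩ := hT.connected.exists_path_of_dist u v
    have := hp.length_lt
    omega
  obtain ⟨d₀, hd₀⟩ := hP
  have hspec : P (Nat.findGreatest P (Fintype.card V)) := Nat.findGreatest_spec (hbd _ hd₀) hd₀
  have hmax : ∀ d, P d → d ≤ Nat.findGreatest P (Fintype.card V) := fun d hd =>
    Nat.le_findGreatest (hbd d hd) hd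
  obtain ⟨f, u, v, hf, huv, hu, hv, hc, hd⟩ := hspec
  refine ⟨tmSub f hf, tmSub_isMatching f hf, ?_, u, v, huv, fun h => h hu, fun h => h hv, ?_, ?_⟩
  · rw [← hc, Set.ncard_eq_toFinset_card']
    congr 1; ext x
    rw [Finset.mem_filter, Set.mem_toFinset]
    exact ⟨fun h => ⟨Finset.mem_univ _, h⟩, fun h => h.2⟩
  · by_contra hdeg
    obtain ⟨f', u', a1, a2, a3, a4, a5, a6⟩ := tm_step hT hf huv hu hv hdeg
    have := hmax _ ⟨f', u', v, a1, a2, a3, a4, a5.trans hc, rfl⟩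
    omega
  · by_contra hdeg
    obtain ⟨f', u', a1, a2, a3, a4, a5, a6⟩ := tm_step hT hf huv.symm hv hu hdeg
    have := hmax _ ⟨f', u', u, a1, a2, a3, a4, a5.trans hc, rfl⟩
    rw [T.dist_comm (u := v)] at a6
    omega
end

section
/- Let q ≥ 2 and let T be a tree with at least 2q+2 vertices that contains a matching of size q. If T is not isomorphic to a path graph, then there exists a set S of q−1 vertices of T such that the graph obtained from T by deleting the vertices of S has at least q+1 connected components. -/
open SimpleGraph Finset

set_option linter.unusedSectionVars false
set_option linter.unusedVariables false

structure RT {V : Type*} (c : V) (par : V → V) (h : V → ℕ) : Prop where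
  h0 : ∀ v, h v = 0 → v = c
  hp : ∀ v, h (par v) = h v - 1
  pc : par c = c
  hc : h c = 0

def SepW.{u} {V : Type u} (par : V → V) (W : Finset V) (s m : ℕ) : Prop :=
  ∃ S : Finset V, S ⊆ W ∧ S.card = s ∧ ∃ (C : Type u) (φ : V → C) (R : Finset V),
    (∀ v ∈ W, v ∉ S → par v ∈ W → par v ∉ S → φ v = φ (par v)) ∧
    R ⊆ W ∧ (∀ v ∈ R, v ∉ S) ∧ R.card = m ∧ Set.InjOn φ R

structure Mtch {V : Type*} (c : V) (par : V → V) (W M : Finset V) : Prop where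
  sub : M ⊆ W
  ne : ∀ v ∈ M, v ≠ c
  psub : ∀ v ∈ M, par v ∈ W
  inj : ∀ v ∈ M, ∀ w ∈ M, par v = par w → v = w
  dj : ∀ v ∈ M, par v ∉ M

section
variable {V : Type*} [DecidableEq V] {c : V} {par : V → V} {h : V → ℕ}

lemma SepW.addLeaf {W : Finset V} {s m : ℕ} (H : SepW par W s m) (l : V) (hl : l ∉ W)
    (h1 : par l ∉ W) (h2 : ∀ v ∈ W, par v ≠ l) : SepW par (insert l W) s (m + 1) := by
  obtain ⟨S, hS, hs, C, φ, R, hφ, hR, hRS, hRm, hinj⟩ := H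
  refine ⟨S, hS.trans (subset_insert _ _), hs, Option C,
    fun v => if v = l then none else some (φ v), insert l R, ?_, ?_, ?_, ?_, ?_⟩
  · intro v hv hvS hpv hpS
    rw [mem_insert] at hv hpv
    rcases hv with rfl | hv
    · rcases hpv with h' | h'
      · rw [h']
      · exact absurd h' h1
    · rcases hpv with h' | h'
      · exact absurd h' (h2 v hv)
      · have a1 : v ≠ l := fun e => hl (e ▸ hv)
        have a2 : par v ≠ l := fun e => hl (e ▸ h')
        simp [a1, a2, hφ v hv hvS h' hpS]
  · exact insert_subset_insert _ hR
  · intro v hv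
    rcases mem_insert.1 hv with rfl | hv
    · exact fun hh => hl (hS hh)
    · exact hRS v hv
  · rw [card_insert_of_notMem (fun hh => hl (hR hh)), hRm]
  · intro a ha b hb hab
    have ha' := mem_insert.1 (mem_coe.1 ha)
    have hb' := mem_insert.1 (mem_coe.1 hb)
    by_cases e1 : a = l <;> by_cases e2 : b = l <;> simp [e1, e2] at hab ha' hb' ⊢
    exact hinj (mem_coe.2 ha') (mem_coe.2 hb') hab

lemma SepW.addS {W : Finset V} {s m : ℕ} (H : SepW par W s m) (u : V) (hu : u ∉ W) :
    SepW par (insert u W) (s + 1) m := by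
  obtain ⟨S, hS, hs, C, φ, R, hφ, hR, hRS, hRm, hinj⟩ := H
  refine ⟨insert u S, insert_subset_insert _ hS, ?_, C, φ, R, ?_, ?_, ?_, hRm, hinj⟩
  · rw [card_insert_of_notMem (fun hh => hu (hS hh)), hs]
  · intro v hv hvS hpv hpS
    grind
  · exact hR.trans (subset_insert _ _)
  · grind

lemma Mtch.remove {W M : Finset V} (H : Mtch c par W M) (u : V) :
    ∃ M' ⊆ M, (∀ v ∈ M', v ≠ u ∧ par v ≠ u) ∧ M.card ≤ M'.card + 1 := by
  refine ⟨M.filter (fun v => v ≠ u ∧ par v ≠ u), filter_subset _ _, by simp, ?_⟩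
  have h1 : (M.filter (fun v => ¬ (v ≠ u ∧ par v ≠ u))).card ≤ 1 := by
    rw [card_le_one]
    intro a ha b hb
    have := H.inj; have := H.dj
    grind
  have := card_filter_add_card_filter_not (s := M) (fun v => v ≠ u ∧ par v ≠ u)
  omega

lemma Mtch.mono {W M W' M' : Finset V} (H : Mtch c par W M) (hM : M' ⊆ M)
    (h1 : M' ⊆ W') (h2 : ∀ v ∈ M', par v ∈ W') : Mtch c par W' M' :=
  ⟨h1, fun v hv => H.ne v (hM hv), h2, fun v hv w hw => H.inj v (hM hv) w (hM hw),
    fun v hv hh => H.dj v (hM hv) (hM hh)⟩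

lemma lemA (rt : RT c par h) (p : ℕ) : ∀ W M : Finset V, Mtch c par W M → p + 1 ≤ M.card →
    SepW par W p (p + 1) := by
  induction p with
  | zero =>
    intro W M hM hc
    obtain ⟨x, hx⟩ := card_pos.1 (show 0 < M.card by omega)
    exact ⟨∅, by simp, rfl, V, fun _ => c, {x}, by simp, by simpa using hM.sub hx, by simp,
      by simp, by simp⟩
  | succ p ih =>
    intro W M hM hc
    obtain ⟨x, hx⟩ := card_pos.1 (show 0 < M.card by omega)
    obtain ⟨l, hl, hmax⟩ := exists_max_image (W.filter (fun v => v ≠ c ∧ par v ∈ W)) h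
      ⟨x, by simp [hM.sub hx, hM.ne x hx, hM.psub x hx]⟩
    simp only [mem_filter] at hl hmax
    obtain ⟨hlW, hlc, hpl⟩ := hl
    have hl0 : h l ≠ 0 := fun e => hlc (rt.h0 l e)
    have hch : ∀ v ∈ W, par v ≠ l := by
      intro v hv e
      have hvc : v ≠ c := by rintro rfl; exact hlc (e ▸ rt.pc)
      have := hmax v ⟨hv, hvc, e ▸ hlW⟩
      have := rt.hp v
      rw [e] at this
      omega
    have hul : par l ≠ l := hch l hlW
    obtain ⟨M', hM', hMu, hMc⟩ := hM.remove (par l)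
    have hs := hM.sub
    have hps := hM.psub
    have := ih ((W.erase (par l)).erase l) M' (hM.mono hM' (by grind) (by grind)) (by omega)
    have h2 := (this.addLeaf l (by simp) (by simp) (by grind))
    have h3 := h2.addS (par l) (by grind)
    convert h3 using 1
    grind

lemma caseB (rt : RT c par h) (q : ℕ) (hq : 2 ≤ q) (W M : Finset V) (hM : Mtch c par W M)
    (hqM : q ≤ M.card) (u l₁ l₂ : V) (hu : u ∈ W) (h1 : l₁ ∈ W) (h2 : l₂ ∈ W) (hne : l₁ ≠ l₂)
    (hc1 : l₁ ≠ c) (hc2 : l₂ ≠ c)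
    (p1 : par l₁ = u) (p2 : par l₂ = u) (n1 : ∀ v ∈ W, par v ≠ l₁) (n2 : ∀ v ∈ W, par v ≠ l₂) :
    SepW par W (q - 1) (q + 1) := by
  obtain ⟨M', hM', hMu, hMc⟩ := hM.remove u
  have hs := hM.sub
  have hps := hM.psub
  have e1 : u ≠ l₁ := fun e => n1 l₁ h1 (p1.trans e)
  have e2 : u ≠ l₂ := fun e => n2 l₂ h2 (p2.trans e)
  have := lemA rt (q - 2) (((W.erase u).erase l₁).erase l₂) M'
    (hM.mono hM' (by grind) (by grind)) (by omega)
  have a1 := this.addLeaf l₂ (by simp) (by grind) (by grind)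
  have a2 := a1.addLeaf l₁ (by grind) (by grind) (by grind)
  have a3 := a2.addS u (by grind)
  convert a3 using 1
  · grind
  · omega
  · omega

def topc (par : V → V) (h : V → ℕ) (v : V) : V := par^[h v - 1] v

lemma topc_par (rt : RT c par h) (v : V) (hv : par v ≠ c) : topc par h v = topc par h (par v) := by
  unfold topc
  have h1 := rt.hp v
  have h2 : h (par v) ≠ 0 := fun e => hv (rt.h0 _ e)
  have : h v - 1 = (h (par v) - 1) + 1 := by omega
  rw [this, Function.iterate_succ_apply]

lemma mainL (rt : RT c par h) (q : ℕ) (hq : 2 ≤ q) : ∀ W M : Finset V, c ∈ W →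
    (∀ v ∈ W, par v ∈ W) → 3 ≤ (W.filter (fun v => h v = 1)).card → Mtch c par W M → q ≤ M.card →
    2 * q + 2 ≤ W.card → SepW par W (q - 1) (q + 1) := by
  induction q, hq using Nat.le_induction with
  | base =>
    intro W M hcW hcl h3 hM hqM hW
    obtain ⟨R, hR, hRc⟩ := exists_subset_card_eq h3
    refine ⟨{c}, by simpa using hcW, by simp, V, topc par h, R, ?_, ?_, ?_, hRc, ?_⟩
    · intro v hv hvc hp hpc
      exact topc_par rt v (by simpa using hpc)
    · exact hR.trans (filter_subset _ _)
    · intro v hv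
      have := hR hv
      have := rt.hc
      grind
    · intro a ha b hb hab
      have := hR ha
      have := hR hb
      simp_all [topc]
  | succ q hq ih =>
    intro W M hcW hcl h3 hM hqM hW
    by_cases hB : ∃ u l₁ l₂ : V, u ∈ W ∧ l₁ ∈ W ∧ l₂ ∈ W ∧ l₁ ≠ l₂ ∧ l₁ ≠ c ∧ l₂ ≠ c ∧
        par l₁ = u ∧ par l₂ = u ∧ (∀ v ∈ W, par v ≠ l₁) ∧ (∀ v ∈ W, par v ≠ l₂)
    · obtain ⟨u, l₁, l₂, a1, a2, a3, a4, a5, a6, a7, a8, a9, a10⟩ := hB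
      exact caseB rt (q + 1) (by omega) W M hM hqM u l₁ l₂ a1 a2 a3 a4 a5 a6 a7 a8 a9 a10
    obtain ⟨l, hlW, hmax⟩ := exists_max_image W h ⟨c, hcW⟩
    by_cases hl : 3 ≤ h l
    · have hpl := rt.hp l
      have hppl := rt.hp (par l)
      have nochild : ∀ x ∈ W, h x = h l → ∀ v ∈ W, par v ≠ x := by
        intro x hx hxl v hv e
        have := hmax v hv
        have := rt.hp v
        rw [e] at this
        omega
      have hul : par l ≠ l := nochild l hlW rfl l hlW
      have hhc := rt.hc
      have hlc : l ≠ c := by rintro rfl; omega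
      have honly : ∀ v ∈ W, par v = par l → v = l := by
        intro v hv e
        by_contra hne
        have hvh := rt.hp v
        rw [e] at hvh
        have : h v = h l := by omega
        exact hB ⟨par l, l, v, hcl l hlW, hlW, hv, fun e => hne e.symm, hlc,
          by rintro rfl; omega, rfl, e, nochild l hlW rfl, nochild v hv this⟩
      clear hB
      obtain ⟨M', hM', hMu, hMc⟩ := hM.remove (par l)
      have hs := hM.sub
      have hps := hM.psub
      have hnl := nochild l hlW rfl
      have := ih ((W.erase (par l)).erase l) M' (by grind) (by grind) ?_
        (hM.mono hM' (by grind) (by grind)) (by omega) ?_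
      · have h2 := (this.addLeaf l (by simp) (by simp) (by grind))
        have h3 := h2.addS (par l) (by grind)
        clear ih
        convert h3 using 1
        · ext x
          have := hcl l hlW
          clear h2 h3 nochild hmax honly hcl
          grind
        · omega
      · refine h3.trans (card_le_card ?_)
        intro v hv
        simp only [mem_filter, mem_erase] at hv ⊢
        refine ⟨⟨?_, ?_, hv.1⟩, hv.2⟩
        · rintro rfl; omega
        · rintro rfl; omega
      · rw [card_erase_of_mem (by grind), card_erase_of_mem (hcl l hlW)]
        omega
    · clear ih
      set A := W.filter (fun v => h v = 1) with hA
      set B := W.filter (fun v => h v = 2) with hBd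
      have hp := rt.hp
      have hh0 := rt.h0
      have hhc := rt.hc
      have hWc : W.card ≤ 1 + A.card + B.card := by
        have : W ⊆ {c} ∪ A ∪ B := by
          intro v hv
          have := hmax v hv
          have := rt.h0 v
          simp only [hA, hBd, mem_union, mem_singleton, mem_filter, hv, true_and]
          by_cases h v = 0
          · tauto
          · omega
        calc W.card ≤ _ := card_le_card this
          _ ≤ _ := card_union_le _ _
          _ ≤ _ := by
            have := card_union_le {c} A
            simp only [card_singleton] at this
            omega
      have leafB : ∀ x ∈ B, ∀ v ∈ W, par v ≠ x := by
        intro x hx v hv e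
        have := hmax v hv
        have := hp v
        have := (mem_filter.1 hx).2
        rw [e] at *
        omega
      have injB : Set.InjOn par B := by
        intro a ha b hb hab
        by_contra hne
        have ha' := mem_filter.1 (mem_coe.1 ha)
        have hb' := mem_filter.1 (mem_coe.1 hb)
        exact hB ⟨par a, a, b, hcl a ha'.1, ha'.1, hb'.1, hne, by rintro rfl; omega,
          by rintro rfl; omega, rfl, hab.symm, leafB a ha, leafB b hb⟩
      have hBA : B.image par ⊆ A := by
        intro x hx
        obtain ⟨b, hb, rfl⟩ := mem_image.1 hx
        have hb' := mem_filter.1 hb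
        have := hp b
        exact mem_filter.2 ⟨hcl b hb'.1, by omega⟩
      have cB : (B.image par).card = B.card := card_image_of_injOn injB
      have parA : ∀ a ∈ A, par a = c := by
        intro a ha
        have ha' := mem_filter.1 ha
        have := hp a
        exact hh0 _ (by omega)
      have hAB : (A \ B.image par).card ≤ 1 := by
        rw [card_le_one]
        intro a ha b hb
        by_contra hne
        obtain ⟨ha1, ha2⟩ := mem_sdiff.1 ha
        obtain ⟨hb1, hb2⟩ := mem_sdiff.1 hb
        have key : ∀ x ∈ A, x ∉ B.image par → ∀ v ∈ W, par v ≠ x := by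
          intro x hx hxn v hv e
          have hx' := mem_filter.1 hx
          have := hp v
          rw [e] at this
          exact hxn (mem_image.2 ⟨v, mem_filter.2 ⟨hv, by omega⟩, e⟩)
        have ha' := mem_filter.1 ha1
        have hb' := mem_filter.1 hb1
        exact hB ⟨c, a, b, hcW, ha'.1, hb'.1, hne, by rintro rfl; omega,
          by rintro rfl; omega, parA a ha1, parA b hb1, key a ha1 ha2, key b hb1 hb2⟩
      clear hB
      have hsd := card_sdiff_add_card_eq_card hBA
      obtain ⟨X, hX, hXc⟩ := exists_subset_card_eq (show q - 1 ≤ (B.image par).card by omega)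
      have hcX : c ∉ X := by
        intro hh
        have := mem_filter.1 (hBA (hX hh))
        omega
      set R' := B.filter (fun b => par b ∈ X) ∪ A \ X with hR'
      have hR'c : q + 1 + 1 ≤ R'.card := by
        have d : Disjoint (B.filter (fun b => par b ∈ X)) (A \ X) := by
          rw [Finset.disjoint_left]
          intro x hx hx'
          have e1 := (mem_filter.1 (mem_filter.1 hx).1).2
          have e2 := (mem_filter.1 (mem_sdiff.1 hx').1).2
          omega
        rw [hR', card_union_of_disjoint d]
        have e1 : X ⊆ (B.filter (fun b => par b ∈ X)).image par := by
          grind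
        have e2 := (card_le_card e1).trans card_image_le
        have e3 := card_sdiff_add_card_eq_card (hX.trans hBA)
        omega
      obtain ⟨R, hR, hRc⟩ := exists_subset_card_eq hR'c
      have mA : ∀ v ∈ A, v ∈ W ∧ h v = 1 := fun v hv => mem_filter.1 hv
      have mB : ∀ v ∈ B, v ∈ W ∧ h v = 2 := fun v hv => mem_filter.1 hv
      have mX : ∀ v ∈ X, v ∈ W ∧ h v = 1 := fun v hv => mA v (hBA (hX hv))
      have hRm : ∀ v ∈ R, (v ∈ B ∧ par v ∈ X) ∨ (v ∈ A ∧ v ∉ X) := by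
        intro v hv
        have := hR hv
        rw [hR', mem_union, mem_filter, mem_sdiff] at this
        exact this
      clear_value A B R'
      refine ⟨insert c X, ?_, ?_, V, topc par h, R, ?_, ?_, ?_, hRc, ?_⟩
      · exact insert_subset hcW (fun v hv => (mX v hv).1)
      · rw [card_insert_of_notMem hcX]; omega
      · intro v hv hvc hp hpc
        exact topc_par rt v (fun e => hpc (e ▸ mem_insert_self _ _))
      · intro v hv
        rcases hRm v hv with h' | h'
        · exact (mB v h'.1).1
        · exact (mA v h'.1).1
      · intro v hv hv'
        rcases mem_insert.1 hv' with rfl | hv'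
        · rcases hRm v hv with h' | h'
          · have := (mB v h'.1).2
            omega
          · have := (mA v h'.1).2
            omega
        · rcases hRm v hv with h' | h'
          · have := (mB v h'.1).2
            have := (mX v hv').2
            omega
          · exact h'.2 hv'
      · have tA : ∀ a ∈ A, topc par h a = a := by
          intro a ha
          simp [topc, (mA a ha).2]
        have tB : ∀ a ∈ B, topc par h a = par a := by
          intro a ha
          simp [topc, (mB a ha).2]
        intro a ha b hb hab
        rcases hRm a ha with h' | h' <;> rcases hRm b hb with h'' | h''
        · rw [tB a h'.1, tB b h''.1] at hab
          exact injB h'.1 h''.1 hab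
        · rw [tB a h'.1, tA b h''.1] at hab
          exact absurd (hab ▸ h'.2) h''.2
        · rw [tA a h'.1, tB b h''.1] at hab
          exact absurd (hab ▸ h''.2) h'.2
        · rwa [tA a h'.1, tA b h''.1] at hab
end

section
variable {V : Type*}

lemma tree_parent (T : SimpleGraph V) (hT : T.IsTree) (c : V) :
    ∃ par : V → V, RT c par (T.dist c) ∧
      ∀ a b, T.Adj a b ↔ (a ≠ c ∧ par a = b) ∨ (b ≠ c ∧ par b = a) := by
  classical
  have hconn := hT.connected
  have ex : ∀ v, ∃ w, (v = c → w = c) ∧ (v ≠ c → T.Adj v w ∧ T.dist c w + 1 = T.dist c v) := by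
    intro v
    by_cases hv : v = c
    · exact ⟨c, by simp [hv]⟩
    · obtain ⟨p, hp⟩ := hconn.exists_walk_length_eq_dist v c
      cases p with
      | nil => exact absurd rfl hv
      | @cons _ w _ hadj p =>
        refine ⟨w, fun e => absurd e hv, fun _ => ⟨hadj, ?_⟩⟩
        have h1 := SimpleGraph.dist_le p
        rw [SimpleGraph.Walk.length_cons] at hp
        have h2 := hconn.dist_triangle (u := v) (v := w) (w := c)
        rw [SimpleGraph.dist_eq_one_iff_adj.2 hadj] at h2
        rw [SimpleGraph.dist_comm (u := c) (v := w), SimpleGraph.dist_comm (u := c) (v := v)]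
        omega
  choose par hpc hpar using ex
  have uniq : ∀ v a b, T.Adj v a → T.Adj v b → T.dist c a + 1 = T.dist c v →
      T.dist c b + 1 = T.dist c v → a = b := by
    intro v a b ha hb h1 h2
    obtain ⟨p, hp⟩ := hconn.exists_walk_length_eq_dist a c
    obtain ⟨p', hp'⟩ := hconn.exists_walk_length_eq_dist b c
    have q1 : (SimpleGraph.Walk.cons ha p).IsPath := by
      apply SimpleGraph.Walk.isPath_of_length_eq_dist
      rw [SimpleGraph.Walk.length_cons, hp, SimpleGraph.dist_comm, h1, SimpleGraph.dist_comm]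
    have q2 : (SimpleGraph.Walk.cons hb p').IsPath := by
      apply SimpleGraph.Walk.isPath_of_length_eq_dist
      rw [SimpleGraph.Walk.length_cons, hp', SimpleGraph.dist_comm, h2, SimpleGraph.dist_comm]
    have := (hT.existsUnique_path v c).unique q1 q2
    have := congrArg (fun w => w.getVert 1) this
    simpa using this
  refine ⟨par, ⟨?_, ?_, hpc c rfl, SimpleGraph.dist_self⟩, ?_⟩
  · intro v hv
    exact ((hconn.dist_eq_zero_iff).1 hv).symm
  · intro v
    by_cases hv : v = c
    · rw [hpc v hv, hv, SimpleGraph.dist_self]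
    · have := (hpar v hv).2
      omega
  · intro a b
    constructor
    · intro hab
      have hne := hT.dist_ne_of_adj c hab
      have hd := hab.diff_dist_adj (u := c)
      rcases Nat.lt_or_gt_of_ne hne with hlt | hlt
      · right
        have hb : b ≠ c := by
          rintro rfl
          rw [SimpleGraph.dist_self] at hlt
          omega
        exact ⟨hb, uniq b _ _ (hpar b hb).1 hab.symm (hpar b hb).2 (by omega)⟩
      · left
        have ha : a ≠ c := by
          rintro rfl
          rw [SimpleGraph.dist_self] at hlt
          omega
        exact ⟨ha, uniq a _ _ (hpar a ha).1 hab (hpar a ha).2 (by omega)⟩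
    · rintro (⟨h1, rfl⟩ | ⟨h1, rfl⟩)
      · exact (hpar a h1).1
      · exact (hpar b h1).1.symm

lemma exists_deg3 [Fintype V] [DecidableEq V] (T : SimpleGraph V) (hT : T.IsTree)
    (hcard : 2 ≤ Fintype.card V) (hn : ∀ n : ℕ, IsEmpty (T ≃g pathGraph n)) :
    ∃ c a₁ a₂ a₃ : V, T.Adj c a₁ ∧ T.Adj c a₂ ∧ T.Adj c a₃ ∧ a₁ ≠ a₂ ∧ a₁ ≠ a₃ ∧ a₂ ≠ a₃ := by
  classical
  by_contra hcon
  push Not at hcon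
  have : Nontrivial V := Fintype.one_lt_card_iff_nontrivial.1 hcard
  obtain ⟨c, hc⟩ := hT.exists_vert_degree_one_of_nontrivial
  obtain ⟨par, rt, hadj⟩ := tree_parent T hT c
  set h := T.dist c with hh
  have hc1 : ∀ a b, T.Adj c a → T.Adj c b → a = b := by
    intro a b ha hb
    rw [← SimpleGraph.card_neighborFinset_eq_degree, card_eq_one] at hc
    obtain ⟨x, hx⟩ := hc
    have e1 := (T.mem_neighborFinset c a).2 ha
    have e2 := (T.mem_neighborFinset c b).2 hb
    rw [hx, mem_singleton] at e1 e2
    rw [e1, e2]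
  have pinj : ∀ a b, a ≠ c → b ≠ c → par a = par b → a = b := by
    intro a b ha hb hab
    have ja : T.Adj (par a) a := (hadj _ _).2 (Or.inr ⟨ha, rfl⟩)
    have jb : T.Adj (par a) b := (hadj _ _).2 (Or.inr ⟨hb, hab.symm⟩)
    by_cases hp : par a = c
    · rw [hp] at ja jb
      exact hc1 a b ja jb
    · have jp : T.Adj (par a) (par (par a)) := (hadj _ _).2 (Or.inl ⟨hp, rfl⟩)
      by_contra hne
      have e1 := rt.hp a
      have e2 := rt.hp (par a)
      have e3 : h a ≠ 0 := fun e => ha (rt.h0 _ e)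
      have e4 : h (par a) ≠ 0 := fun e => hp (rt.h0 _ e)
      have e5 := rt.hp b
      rw [← hab] at e5
      have := hcon (par a) a b (par (par a)) ja jb jp hne
        (fun e => by rw [← e] at e2; omega)
      rw [← this] at e2
      omega
  have hinj : ∀ n a b, h a = n → h b = n → a = b := by
    intro n
    induction n with
    | zero =>
      intro a b ha hb
      rw [rt.h0 a ha, rt.h0 b hb]
    | succ n ih =>
      intro a b ha hb
      apply pinj a b
      · rintro rfl; have := rt.hc; omega
      · rintro rfl; have := rt.hc; omega
      · apply ih
        · rw [rt.hp, ha]; rfl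
        · rw [rt.hp, hb]; rfl
  have hdown : ∀ d v, ∃ w, h w = h v - d := by
    intro d
    induction d with
    | zero => exact fun v => ⟨v, rfl⟩
    | succ d ih =>
      intro v
      obtain ⟨w, hw⟩ := ih v
      exact ⟨par w, by rw [rt.hp, hw]; omega⟩
  have hlt : ∀ v, h v < Fintype.card V := by
    intro v
    have hs : range (h v + 1) ⊆ univ.image h := by
      intro k hk
      have := mem_range.1 hk
      obtain ⟨w, hw⟩ := hdown (h v - k) v
      exact mem_image.2 ⟨w, mem_univ _, by omega⟩
    have := (card_le_card hs).trans card_image_le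
    rw [card_range, card_univ] at this
    omega
  have hbij : Function.Bijective (fun v => (⟨h v, hlt v⟩ : Fin (Fintype.card V))) := by
    rw [Fintype.bijective_iff_injective_and_card]
    refine ⟨fun a b hab => hinj _ a b rfl ?_, by simp⟩
    exact (Fin.mk.inj hab).symm
  refine (hn (Fintype.card V)).false ⟨Equiv.ofBijective _ hbij, ?_⟩
  intro a b
  simp only [Equiv.ofBijective_apply, pathGraph_adj]
  rw [hadj]
  have key : ∀ a b, h a + 1 = h b ↔ (b ≠ c ∧ par b = a) := by
    intro a b
    constructor
    · intro e
      refine ⟨?_, hinj _ _ _ rfl ?_⟩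
      · rintro rfl; have := rt.hc; omega
      · rw [rt.hp]; omega
    · rintro ⟨hb, rfl⟩
      have := rt.hp b
      have e3 : h b ≠ 0 := fun e => hb (rt.h0 _ e)
      omega
  rw [key, key]
  tauto
end

/-- a non-path tree on at least `2q+2` vertices with a matching of size
`q ≥ 2` has a set of `q-1` vertices whose deletion leaves at least `q+1` connected
components. -/
theorem nonPath_tree_separating_set {V : Type*} [Fintype V] [DecidableEq V]
    (q : ℕ) (hq : 2 ≤ q) (T : SimpleGraph V) (hT : T.IsTree)
    (hcard : 2 * q + 2 ≤ Fintype.card V)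
    (hmatch : ∃ M : T.Subgraph, M.IsMatching ∧ M.verts.ncard = 2 * q)
    (hnotpath : ∀ n : ℕ, IsEmpty (T ≃g pathGraph n)) :
    ∃ S : Finset V, S.card = q - 1 ∧
      q + 1 ≤ Nat.card ((T.induce ((S : Set V)ᶜ)).ConnectedComponent) := by
  classical
  obtain ⟨c, a₁, a₂, a₃, j1, j2, j3, n12, n13, n23⟩ := exists_deg3 T hT (by omega) hnotpath
  obtain ⟨par, rt, hadj⟩ := tree_parent T hT c
  obtain ⟨M, hM, hMc⟩ := hmatch
  have h3 : 3 ≤ ((univ : Finset V).filter (fun v => T.dist c v = 1)).card := by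
    have : ({a₁, a₂, a₃} : Finset V) ⊆ univ.filter (fun v => T.dist c v = 1) := by
      intro x hx
      simp only [mem_insert, mem_singleton] at hx
      simp only [mem_filter, mem_univ, true_and, SimpleGraph.dist_eq_one_iff_adj]
      rcases hx with rfl | rfl | rfl <;> assumption
    have h' := card_le_card this
    rwa [card_eq_three.2 ⟨a₁, a₂, a₃, n12, n13, n23, rfl⟩] at h'
  set L : Finset V := univ.filter (fun v => v ≠ c ∧ M.Adj v (par v)) with hL
  have mL : ∀ v, v ∈ L ↔ v ≠ c ∧ M.Adj v (par v) := by simp [hL]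
  have hmt : Mtch c par univ L := by
    refine ⟨subset_univ _, fun v hv => ((mL v).1 hv).1, fun _ _ => mem_univ _, ?_, ?_⟩
    · intro v hv w hw e
      have e1 := ((mL v).1 hv).2.symm
      have e2 := ((mL w).1 hw).2.symm
      rw [← e] at e2
      exact (hM (M.edge_vert e1)).unique e1 e2
    · intro v hv hpv
      have e1 := ((mL v).1 hv).2.symm
      obtain ⟨hp, e2⟩ := (mL _).1 hpv
      have e := (hM (M.edge_vert e1)).unique e1 e2
      have d1 := rt.hp v
      have d2 := rt.hp (par v)
      have d3 : T.dist c v ≠ 0 := fun e => ((mL v).1 hv).1 (rt.h0 _ e)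
      rw [← e] at d2
      omega
  have hLc : q ≤ L.card := by
    have hs : M.verts ⊆ ((L ∪ L.image par : Finset V) : Set V) := by
      intro v hv
      obtain ⟨w, hw, -⟩ := hM hv
      rw [mem_coe, mem_union, mem_image]
      rcases (hadj v w).1 hw.adj_sub with ⟨h1, rfl⟩ | ⟨h1, rfl⟩
      · exact Or.inl ((mL v).2 ⟨h1, hw⟩)
      · exact Or.inr ⟨w, (mL w).2 ⟨h1, hw.symm⟩, rfl⟩
    have h1 := Set.ncard_le_ncard hs (Finset.finite_toSet _)
    rw [Set.ncard_coe_finset] at h1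
    have h2 := card_union_le L (L.image par)
    have h4 : (L.image par).card ≤ L.card := card_image_le
    omega
  obtain ⟨S, -, hS, C, φ, R, hφ, -, hRS, hRc, hinj⟩ := mainL rt q hq univ L (mem_univ _)
    (fun _ _ => mem_univ _) h3 hmt hLc (by rwa [card_univ])
  refine ⟨S, hS, ?_⟩
  have hφ' : ∀ a b : ((S : Set V)ᶜ : Set V), (T.induce ((S : Set V)ᶜ)).Adj a b →
      φ a = φ b := by
    rintro ⟨a, ha⟩ ⟨b, hb⟩ hab
    have ha' : a ∉ S := ha
    have hb' : b ∉ S := hb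
    rcases (hadj a b).1 hab with ⟨-, rfl⟩ | ⟨-, rfl⟩
    · exact hφ a (mem_univ _) ha' (mem_univ _) hb'
    · exact (hφ b (mem_univ _) hb' (mem_univ _) ha').symm
  have hreach : ∀ a b : ((S : Set V)ᶜ : Set V), (T.induce ((S : Set V)ᶜ)).Reachable a b →
      φ a = φ b := by
    rintro a b ⟨p⟩
    induction p with
    | nil => rfl
    | cons hab p ih => exact (hφ' _ _ hab).trans ih
  let f : R → (T.induce ((S : Set V)ᶜ)).ConnectedComponent :=
    fun r => (T.induce ((S : Set V)ᶜ)).connectedComponentMk ⟨r.1, hRS r.1 r.2⟩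
  have hf : Function.Injective f := by
    intro a b hab
    have := hreach _ _ (SimpleGraph.ConnectedComponent.exact hab)
    exact Subtype.ext (hinj a.2 b.2 this)
  have := Nat.card_le_card_of_injective f hf
  rwa [Nat.card_eq_fintype_card, Fintype.card_coe, hRc] at this
end

section
/- Let q ≥ 2 and let G be a disconnected forest that contains a matching of size q and whose vertex set V(G) is not a union of q cliques of G. Then there exists a set S of q−1 vertices of G such that the graph obtained from G by deleting the vertices of S has at least q+1 connected components. -/
open SimpleGraph Finset

lemma aux_add {V : Type*} [Fintype V] (G : SimpleGraph V) (A B : Set V) (v : V)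
    (hB : B = insert v A) (hv : v ∉ A)
    (h1 : ∀ x ∈ A, ∀ y ∈ A, G.Adj v x → G.Adj v y → x = y) :
    Nat.card (G.induce A).ConnectedComponent ≤ Nat.card (G.induce B).ConnectedComponent := by
  classical
  rcases A.eq_empty_or_nonempty with hA | ⟨a, ha⟩
  · subst hA
    have : IsEmpty (G.induce (∅ : Set V)).ConnectedComponent :=
      ⟨fun c => by
        induction c using ConnectedComponent.ind with
        | h w => exact w.2⟩
    simp
  obtain ⟨u, hu, hu'⟩ : ∃ u, ∃ _ : u ∈ A, ∀ x ∈ A, G.Adj v x → x = u := by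
    by_cases h : ∃ u ∈ A, G.Adj v u
    · obtain ⟨u, hu, huv⟩ := h
      exact ⟨u, hu, fun x hx hvx => h1 x hx u hu hvx huv⟩
    · exact ⟨a, ha, fun x hx hvx => absurd ⟨x, hx, hvx⟩ h⟩
  let f : B → (G.induce A).ConnectedComponent := fun x =>
    if hx : x.1 ∈ A then (G.induce A).connectedComponentMk ⟨x.1, hx⟩
    else (G.induce A).connectedComponentMk ⟨u, hu⟩
  have hf : ∀ x y : B, (G.induce B).Adj x y → f x = f y := by
    rintro ⟨x, hx⟩ ⟨y, hy⟩ hxy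
    have hxy' : G.Adj x y := hxy
    by_cases hxA : x ∈ A <;> by_cases hyA : y ∈ A
    · simp only [f, hxA, hyA, dif_pos]
      exact ConnectedComponent.sound (Adj.reachable (by simpa using hxy'))
    · have : y = v := by subst hB; exact (Set.mem_insert_iff.1 hy).resolve_right hyA
      subst this
      have := hu' x hxA hxy'.symm
      subst this
      simp [f, hxA, hyA]
    · have : x = v := by subst hB; exact (Set.mem_insert_iff.1 hx).resolve_right hxA
      subst this
      have := hu' y hyA hxy'
      subst this
      simp [f, hxA, hyA]
    · simp [f, hxA, hyA]
  have hw : ∀ (x y : B) (p : (G.induce B).Walk x y), f x = f y := by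
    intro x y p
    induction p with
    | nil => rfl
    | cons h p ih => exact (hf _ _ h).trans ih
  apply Nat.card_le_card_of_surjective (ConnectedComponent.lift f (fun x y p _ => hw x y p))
  intro c
  induction c using ConnectedComponent.ind with
  | h w =>
    refine ⟨(G.induce B).connectedComponentMk ⟨w.1, by subst hB; exact Or.inr w.2⟩, ?_⟩
    simp [f]

lemma aux_del {V : Type*} [Fintype V] (G : SimpleGraph V) (hG : G.IsAcyclic) (A B : Set V) (v : V)
    (hB : B = insert v A) (hv : v ∉ A) (x y : V) (hx : x ∈ A) (hy : y ∈ A) (hne : x ≠ y)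
    (hvx : G.Adj v x) (hvy : G.Adj v y) :
    Nat.card (G.induce B).ConnectedComponent < Nat.card (G.induce A).ConnectedComponent := by
  classical
  have hAB : A ⊆ B := by subst hB; exact Set.subset_insert _ _
  let φ : G.induce A →g G.induce B := ⟨fun z => ⟨z.1, hAB z.2⟩, fun h => h⟩
  have hvB : v ∈ B := by subst hB; exact Set.mem_insert _ _
  have key : Function.Surjective (ConnectedComponent.map φ) → ¬ Function.Injective (ConnectedComponent.map φ) →
      Nat.card (G.induce B).ConnectedComponent < Nat.card (G.induce A).ConnectedComponent := by
    intro hs hi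
    by_contra hlt
    exact hi (hs.bijective_of_nat_card_le (not_lt.1 hlt)).1
  apply key
  · intro c
    induction c using ConnectedComponent.ind with
    | h w =>
      by_cases hw : w.1 ∈ A
      · exact ⟨(G.induce A).connectedComponentMk ⟨w.1, hw⟩, rfl⟩
      · have : w.1 = v := by
          have := w.2
          subst hB; exact (Set.mem_insert_iff.1 this).resolve_right hw
        refine ⟨(G.induce A).connectedComponentMk ⟨x, hx⟩, ?_⟩
        apply ConnectedComponent.sound
        apply Adj.reachable
        change G.Adj x w.1
        rw [this]; exact hvx.symm
  · intro hinj
    have h1 : (G.induce A).connectedComponentMk ⟨x, hx⟩ = (G.induce A).connectedComponentMk ⟨y, hy⟩ := by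
      apply hinj
      apply ConnectedComponent.sound
      have e1 : (G.induce B).Adj ⟨x, hAB hx⟩ ⟨v, hvB⟩ := hvx.symm
      have e2 : (G.induce B).Adj ⟨v, hvB⟩ ⟨y, hAB hy⟩ := hvy
      exact e1.reachable.trans e2.reachable
    obtain ⟨p, hp⟩ := (ConnectedComponent.exact h1).exists_isPath
    let ψ : G.induce A →g G := ⟨Subtype.val, fun h => h⟩
    have hp' : (p.map ψ).IsPath := Walk.map_isPath_of_injective Subtype.val_injective hp
    let r : G.Walk x y := Walk.cons hvx.symm (Walk.cons hvy Walk.nil)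
    have hr : r.IsPath := by
      simp [r, Walk.cons_isPath_iff, hvx.ne', hvy.ne, hne]
    have := hG.path_unique ⟨r, hr⟩ ⟨p.map ψ, hp'⟩
    have h2 : v ∈ (p.map ψ).support := by
      have h3 : r = p.map ψ := congrArg Subtype.val this
      rw [← h3]; simp [r]
    rw [Walk.support_map] at h2
    obtain ⟨z, _, hz⟩ := List.mem_map.1 h2
    have hz' : z.1 = v := hz
    exact hv (hz' ▸ z.2)

lemma aux_leaf {V : Type*} [Finite V] (G : SimpleGraph V) (hG : G.IsAcyclic) [Nonempty V] :
    ∃ v, ∀ x y, G.Adj v x → G.Adj v y → x = y := by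
  have := Fintype.ofFinite V
  classical
  let c := G.connectedComponentMk (Classical.arbitrary V)
  have hT := hG.isTree_connectedComponent c
  rcases subsingleton_or_nontrivial c with h | h
  · refine ⟨Classical.arbitrary V, fun x y hx hy => ?_⟩
    have h1 : x ∈ c := ConnectedComponent.sound hx.reachable.symm
    have h2 : y ∈ c := ConnectedComponent.sound hy.reachable.symm
    exact congrArg Subtype.val (Subsingleton.elim (⟨x, h1⟩ : c) ⟨y, h2⟩)
  · obtain ⟨v, hv⟩ := hT.exists_vert_degree_one_of_nontrivial
    obtain ⟨w, hw, hw'⟩ := degree_eq_one_iff_existsUnique_adj.1 hv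
    have key : ∀ x, G.Adj v.1 x → x = w.1 := by
      intro x hx
      have h1 : x ∈ c := by
        have := v.2
        exact (ConnectedComponent.sound hx.reachable.symm).trans this
      exact congrArg Subtype.val (hw' ⟨x, h1⟩ hx)
    exact ⟨v.1, fun x y hx hy => (key x hx).trans (key y hy).symm⟩

lemma aux_cover_s14 {V : Type*} [Fintype V] [DecidableEq V] (G : SimpleGraph V) (hG : G.IsAcyclic)
    (q : ℕ) : ∀ W : Set V, CliqueCoverable G q W ∨
      ∃ I : Finset V, (I : Set V) ⊆ W ∧ I.card = q + 1 ∧ _root_.IsIndepSet G (I : Set V) := by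
  induction q with
  | zero =>
    intro W
    rcases W.eq_empty_or_nonempty with h | ⟨a, ha⟩
    · left
      exact ⟨fun _ => ∅, fun _ => by simp, by simp [h]⟩
    · right
      exact ⟨{a}, by simpa using ha, by simp, by
        intro x hx y hy hne; simp at hx hy; exact absurd (hx.trans hy.symm) hne⟩
  | succ q ih =>
    intro W
    rcases W.eq_empty_or_nonempty with h | ⟨a, ha⟩
    · left
      exact ⟨fun _ => ∅, fun _ => by simp, by simp [h]⟩
    · have : Nonempty W := ⟨⟨a, ha⟩⟩
      obtain ⟨v, hv⟩ := aux_leaf (G.induce W) (hG.induce W)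
      have hv' : ∀ x ∈ W, ∀ y ∈ W, G.Adj v.1 x → G.Adj v.1 y → x = y := fun x hx y hy h1 h2 =>
        congrArg Subtype.val (hv ⟨x, hx⟩ ⟨y, hy⟩ h1 h2)
      let K : Set V := {x | x ∈ W ∧ (x = v.1 ∨ G.Adj v.1 x)}
      rcases ih (W \ K) with ⟨f, hf, hfW⟩ | ⟨I, hI, hc, hind⟩
      · left
        refine ⟨Fin.cons K f, ?_, ?_⟩
        · intro i
          refine Fin.cases ?_ (fun j => ?_) i
          · rintro x ⟨hx, hx'⟩ y ⟨hy, hy'⟩ hne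
            rcases hx' with rfl | hx' <;> rcases hy' with rfl | hy'
            · exact absurd rfl hne
            · exact hy'
            · exact hx'.symm
            · exact absurd (hv' x hx y hy hx' hy') hne
          · exact hf j
        · have hK : K ⊆ W := fun x hx => hx.1
          ext x
          rw [Set.mem_iUnion, Fin.exists_fin_succ]
          simp only [Fin.cons_zero, Fin.cons_succ]
          rw [← Set.mem_iUnion, ← hfW]
          constructor
          · intro hx
            by_cases h : x ∈ K
            · exact Or.inl h
            · exact Or.inr ⟨hx, h⟩
          · rintro (h | h)
            · exact hK h
            · exact h.1
      · right
        have hvI : v.1 ∉ I := fun h => (hI h).2 ⟨v.2, Or.inl rfl⟩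
        refine ⟨insert v.1 I, ?_, ?_, ?_⟩
        · intro x hx
          rcases Finset.mem_insert.1 (Finset.mem_coe.1 hx) with rfl | hx
          · exact v.2
          · exact (hI hx).1
        · rw [Finset.card_insert_of_notMem hvI, hc]
        · intro x hx y hy hne hadj
          rcases Finset.mem_insert.1 (Finset.mem_coe.1 hx) with rfl | hx <;>
            rcases Finset.mem_insert.1 (Finset.mem_coe.1 hy) with rfl | hy
          · exact hne rfl
          · exact (hI hy).2 ⟨(hI hy).1, Or.inr hadj⟩
          · exact (hI hx).2 ⟨(hI hx).1, Or.inr hadj.symm⟩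
          · exact hind x hx y hy hne hadj

lemma aux_indep {V : Type*} [Fintype V] (G : SimpleGraph V) (I : Finset V)
    (hI : _root_.IsIndepSet G (I : Set V)) (A : Set V) (hA : A = (I : Set V)) :
    I.card ≤ Nat.card (G.induce A).ConnectedComponent := by
  subst hA
  have : Nat.card (I : Set V) = I.card := by simp
  rw [← this]
  apply Nat.card_le_card_of_injective (fun x => (G.induce (I : Set V)).connectedComponentMk x)
  intro x y h
  obtain ⟨p⟩ := ConnectedComponent.exact h
  cases p with
  | nil => rfl
  | cons h p => exact absurd h (hI _ x.2 _ (Subtype.prop _) (fun e => h.ne (Subtype.ext e)))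

lemma aux_many {V : Type*} [Fintype V] [DecidableEq V] (G : SimpleGraph V) (hG : G.IsAcyclic)
    (S : Finset V)
    (hS : ∀ v ∈ S, ∃ x ∉ S, ∃ y ∉ S, x ≠ y ∧ G.Adj v x ∧ G.Adj v y)
    (h2 : 2 ≤ Nat.card (G.induce (((∅ : Finset V) : Set V)ᶜ)).ConnectedComponent)
    (T : Finset V) : T ⊆ S →
    T.card + 2 ≤ Nat.card (G.induce ((T : Set V)ᶜ)).ConnectedComponent := by
  induction T using Finset.induction_on with
  | empty => intro _; simpa using h2
  | insert a T ha ih =>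
    intro hT
    have h1 := ih (fun x hx => hT (Finset.mem_insert_of_mem hx))
    have haS := hT (Finset.mem_insert_self a T)
    obtain ⟨x, hx, y, hy, hne, hax, hay⟩ := hS a haS
    have := aux_del G hG (((insert a T : Finset V) : Set V)ᶜ) ((T : Set V)ᶜ) a (by
      ext z
      simp only [Set.mem_compl_iff, Finset.mem_coe, Set.mem_insert_iff, Finset.mem_insert]
      by_cases hz : z = a
      · subst hz; simp [ha]
      · simp [hz]) (by simp) x y (fun h => hx (hT h)) (fun h => hy (hT h)) hne hax hay
    rw [Finset.card_insert_of_notMem ha]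
    omega

lemma aux_main {V : Type*} [Fintype V] [DecidableEq V] (G : SimpleGraph V) (hG : G.IsAcyclic)
    (h2 : 2 ≤ Nat.card (G.induce (((∅ : Finset V) : Set V)ᶜ)).ConnectedComponent)
    (k d : ℕ) : ∀ S : Finset V, S.card = k + d →
      k + 2 ≤ Nat.card (G.induce ((S : Set V)ᶜ)).ConnectedComponent →
      ∃ S : Finset V, S.card = k ∧
        k + 2 ≤ Nat.card (G.induce ((S : Set V)ᶜ)).ConnectedComponent := by
  induction d with
  | zero => intro S h h'; exact ⟨S, h, h'⟩
  | succ d ih =>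
    intro S hS h
    by_cases hc : ∀ v ∈ S, ∃ x ∉ S, ∃ y ∉ S, x ≠ y ∧ G.Adj v x ∧ G.Adj v y
    · obtain ⟨T, hTS, hT⟩ := Finset.exists_subset_card_eq (s := S) (n := k) (by omega)
      exact ⟨T, hT, hT ▸ aux_many G hG S hc h2 T hTS⟩
    · push Not at hc
      obtain ⟨v, hv, hc⟩ := hc
      apply ih (S.erase v)
      · rw [Finset.card_erase_of_mem hv]; omega
      · refine h.trans (aux_add G ((S : Set V)ᶜ) _ v ?_ (by simpa using hv) ?_)
        · ext z
          simp only [Set.mem_compl_iff, Finset.mem_coe, Set.mem_insert_iff, Finset.mem_erase]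
          tauto
        · intro x hx y hy hvx hvy
          by_contra hne
          exact hc x hx y hy hne hvx hvy

/-- a disconnected forest with a matching of size `q ≥ 2` whose vertex
set is not a union of `q` cliques has a set of `q-1` vertices whose deletion leaves at
least `q+1` connected components. -/
theorem disconnected_forest_separating_set {V : Type*} [Fintype V] [DecidableEq V]
    [Nonempty V] (q : ℕ) (hq : 2 ≤ q) (G : SimpleGraph V) (hforest : G.IsAcyclic)
    (hdisc : ¬G.Connected)
    (hmatch : ∃ M : G.Subgraph, M.IsMatching ∧ M.verts.ncard = 2 * q)
    (hnotcov : ¬CliqueCoverable G q Set.univ) :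
    ∃ S : Finset V, S.card = q - 1 ∧
      q + 1 ≤ Nat.card ((G.induce ((S : Set V)ᶜ)).ConnectedComponent) := by
  obtain ⟨M, -, hM⟩ := hmatch
  have hn : 2 * q ≤ Fintype.card V := by
    rw [← hM, ← Nat.card_eq_fintype_card]
    exact Set.ncard_le_card _
  obtain ⟨I, -, hIc, hI⟩ := (aux_cover_s14 G hforest q Set.univ).resolve_left hnotcov
  have h2 : 2 ≤ Nat.card (G.induce (((∅ : Finset V) : Set V)ᶜ)).ConnectedComponent := by
    by_contra hlt
    apply hdisc
    have hsub : Subsingleton (G.induce (((∅ : Finset V) : Set V)ᶜ)).ConnectedComponent :=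
      Finite.card_le_one_iff_subsingleton.1 (by omega)
    refine ⟨fun u v => ?_⟩
    have := ConnectedComponent.exact (Subsingleton.elim
      ((G.induce (((∅ : Finset V) : Set V)ᶜ)).connectedComponentMk ⟨u, by simp⟩)
      ((G.induce (((∅ : Finset V) : Set V)ᶜ)).connectedComponentMk ⟨v, by simp⟩))
    exact this.map (⟨Subtype.val, fun h => h⟩ : G.induce (((∅ : Finset V) : Set V)ᶜ) →g G)
  have h3 := aux_indep G I hI (((Iᶜ : Finset V) : Set V)ᶜ) (by simp)
  have h4 := Finset.card_compl I
  have h5 : q - 1 + 2 = q + 1 := by omega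
  rw [← h5]
  exact aux_main G hforest h2 (q - 1) ((Iᶜ : Finset V).card - (q - 1)) Iᶜ (by omega) (by omega)
end

section
/- Let q ≥ 1 and let T₀ be a tree on q+1 vertices. Let T be the graph whose vertex set is the disjoint union V(T₀) ⊔ E(T₀), in which v ∈ V(T₀) is adjacent to e ∈ E(T₀) if and only if v is an endpoint of e, and with no other adjacencies (the subdivision of T₀). Then the matching number of T equals q, that is, ν(T) = q. -/
open SimpleGraph Finset

/-- The subdivision of a graph `T₀`: its vertices are the vertices and the edges of
`T₀`, and `v` is adjacent to `e` iff `v` is an endpoint of `e`. -/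
def subdivision {V : Type*} (T₀ : SimpleGraph V) : SimpleGraph (V ⊕ T₀.edgeSet) :=
  SimpleGraph.fromRel (fun x y =>
    ∃ (v : V) (e : T₀.edgeSet), x = Sum.inl v ∧ y = Sum.inr e ∧ v ∈ e.1)

theorem sub_adj {V : Type*} (T : SimpleGraph V) (v : V) (e : T.edgeSet) (h : v ∈ e.1) :
    (subdivision T).Adj (Sum.inl v) (Sum.inr e) := by
  simp [subdivision, SimpleGraph.fromRel_adj, h]

theorem sub_adj_inl {V : Type*} (T : SimpleGraph V) (v : V) (y : V ⊕ T.edgeSet)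
    (h : (subdivision T).Adj (Sum.inl v) y) : ∃ e, y = Sum.inr e := by
  simp only [subdivision, SimpleGraph.fromRel_adj] at h
  obtain ⟨_, ⟨a, e, _, h, _⟩ | ⟨a, e, _, h, _⟩⟩ := h
  · exact ⟨e, h⟩
  · simp at h

theorem exists_parent {V : Type*} (T : SimpleGraph V) (hT : T.Connected) (r : V)
    (v : {v : V // v ≠ r}) : ∃ w, T.Adj v.1 w ∧ T.dist w r < T.dist v.1 r := by
  obtain ⟨v, hv⟩ := v
  obtain ⟨p, hp⟩ : ∃ p : T.Walk v r, p.length = T.dist v r := hT.exists_walk_length_eq_dist v r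
  cases p with
  | nil => exact absurd rfl hv
  | cons h p =>
    refine ⟨_, h, ?_⟩
    have := T.dist_le p
    simp at hp
    simp
    omega

/-- the subdivision of a tree on `q+1` vertices has matching number
exactly `q`: there is a matching of size `q`, and every matching has size at most `q`. -/
theorem subdivision_matching_number {V : Type*} [Fintype V] [DecidableEq V]
    (q : ℕ) (hq : 1 ≤ q) (T₀ : SimpleGraph V) [DecidableRel T₀.Adj]
    (hT₀ : T₀.IsTree) (hcard : Fintype.card V = q + 1) :
    (∃ M : (subdivision T₀).Subgraph, M.IsMatching ∧ M.verts.ncard = 2 * q) ∧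
      ∀ M : (subdivision T₀).Subgraph, M.IsMatching → M.verts.ncard ≤ 2 * q := by
  have hE : Nat.card T₀.edgeSet = q := by
    have := hT₀.card_edgeFinset
    rw [Nat.card_eq_fintype_card, ← SimpleGraph.edgeFinset_card]
    omega
  constructor
  · obtain ⟨r⟩ := hT₀.1.nonempty
    choose p hp hd using exists_parent T₀ hT₀.1 r
    let g : {v : V // v ≠ r} → T₀.edgeSet := fun v => ⟨s(v.1, p v), hp v⟩
    have hg : Function.Injective g := by
      intro v w h
      have h' : s(v.1, p v) = s(w.1, p w) := congrArg Subtype.val h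
      rw [Sym2.eq_iff] at h'
      rcases h' with ⟨h1, _⟩ | ⟨h1, h2⟩
      · exact Subtype.ext h1
      · have a := hd v
        have b := hd w
        rw [h2] at a
        rw [← h1] at b
        omega
    let M : (subdivision T₀).Subgraph :=
      { verts := Set.range (fun v : {v : V // v ≠ r} => (Sum.inl v.1 : V ⊕ T₀.edgeSet)) ∪
          Set.range (fun v => Sum.inr (g v))
        Adj := fun x y => ∃ v : {v : V // v ≠ r}, (x = Sum.inl v.1 ∧ y = Sum.inr (g v)) ∨
          (y = Sum.inl v.1 ∧ x = Sum.inr (g v))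
        adj_sub := by
          rintro x y ⟨v, ⟨rfl, rfl⟩ | ⟨rfl, rfl⟩⟩
          · exact sub_adj T₀ _ _ (by simp [g])
          · exact (sub_adj T₀ _ _ (by simp [g])).symm
        edge_vert := by
          rintro x y ⟨v, ⟨rfl, rfl⟩ | ⟨rfl, rfl⟩⟩
          · exact Or.inl ⟨v, rfl⟩
          · exact Or.inr ⟨v, rfl⟩
        symm := by
          constructor
          rintro x y ⟨v, h⟩
          exact ⟨v, h.symm⟩ }
    refine ⟨M, ?_, ?_⟩
    · rintro x (⟨v, rfl⟩ | ⟨v, rfl⟩)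
      · refine ⟨Sum.inr (g v), ⟨v, Or.inl ⟨rfl, rfl⟩⟩, ?_⟩
        rintro y ⟨w, ⟨h1, h2⟩ | ⟨h1, h2⟩⟩
        · have : v = w := Subtype.ext (Sum.inl_injective h1)
          rw [h2, this]
        · simp at h2
      · refine ⟨Sum.inl v.1, ⟨v, Or.inr ⟨rfl, rfl⟩⟩, ?_⟩
        rintro y ⟨w, ⟨h1, h2⟩ | ⟨h1, h2⟩⟩
        · simp at h1
        · have : v = w := hg (Sum.inr_injective h2)
          rw [h1, this]
    · have hc : Nat.card {v : V // v ≠ r} = q := by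
        rw [Nat.card_eq_fintype_card, Fintype.card_subtype_compl, hcard]
        simp
      change (_ ∪ _ : Set (V ⊕ T₀.edgeSet)).ncard = _
      rw [Set.ncard_union_eq]
      · have e1 := Set.ncard_image_of_injective (Set.univ : Set {v : V // v ≠ r})
          ((Sum.inl_injective (β := T₀.edgeSet)).comp Subtype.val_injective)
        have e2 := Set.ncard_image_of_injective (Set.univ : Set {v : V // v ≠ r})
          ((Sum.inr_injective (α := V)).comp hg)
        rw [Set.ncard_univ, hc, Set.image_univ] at e1 e2
        simp only [Function.comp_def] at e1 e2
        rw [e1, e2]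
        omega
      · rw [Set.disjoint_left]
        rintro _ ⟨v, rfl⟩ ⟨w, h⟩
        simp at h
  · intro M hM
    have hv : M.verts = Sum.inl '' (Sum.inl ⁻¹' M.verts) ∪ Sum.inr '' (Sum.inr ⁻¹' M.verts) := by
      ext x
      cases x <;> simp
    have hA : (Sum.inl ⁻¹' M.verts : Set V).ncard ≤ q := by
      have : ∀ a : (Sum.inl ⁻¹' M.verts : Set V), ∃ e, M.Adj (Sum.inl a.1) (Sum.inr e) := by
        rintro ⟨a, ha⟩
        obtain ⟨y, hy, _⟩ := hM ha
        obtain ⟨e, rfl⟩ := sub_adj_inl T₀ a y (M.adj_sub hy)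
        exact ⟨e, hy⟩
      choose f hf using this
      rw [← hE, ← Nat.card_coe_set_eq]
      refine Nat.card_le_card_of_injective f ?_
      intro a b hab
      have h1 := hf a
      have h2 := hf b
      rw [← hab] at h2
      exact Subtype.ext (Sum.inl_injective (hM.eq_of_adj_right h1 h2))
    have hB : (Sum.inr ⁻¹' M.verts : Set T₀.edgeSet).ncard ≤ q := by
      rw [← hE]
      exact Set.ncard_le_card _
    rw [hv]
    refine (Set.ncard_union_le _ _).trans ?_
    rw [Set.ncard_image_of_injective _ Sum.inl_injective,
      Set.ncard_image_of_injective _ Sum.inr_injective]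
    omega
end

section
/- Let Δ be a simplicial complex on a finite vertex set V, let F be a face of Δ, and let q ≥ 1 be an integer. Then σ_q(Δ/F) = (σ_qΔ)/F, where for a simplicial complex Γ containing F as a face the face contraction Γ/F is the simplicial complex on (V ∖ F) ∪ {z} (z a new vertex) whose faces are the sets (G ∖ F) ∪ {z} for faces G of Γ with G ∩ F ≠ ∅ together with the faces G of Γ with G ∩ F = ∅. -/
open SimpleGraph Finset

/-- Face contraction `Γ/F`: the new vertex `z` is modelled by `none : Option V`, and
the old vertices by `some`.  Faces of `Γ` meeting `F` become `(G ∖ F) ∪ {z}`; faces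
disjoint from `F` are kept. -/
def faceContract {V : Type*} [DecidableEq V] (Γ : Set (Finset V)) (F : Finset V) :
    Set (Finset (Option V)) :=
  {G' | ∃ G ∈ Γ,
    (¬Disjoint G F ∧ G' = insert none ((G \ F).image Option.some)) ∨
    (Disjoint G F ∧ G' = G.image Option.some)}

theorem faceContract_eq_image {V : Type*} [DecidableEq V] (Γ : Set (Finset V)) (F : Finset V) :
    faceContract Γ F =
      {G' | ∃ G ∈ Γ, G' = G.image (fun v => if v ∈ F then none else some v)} := by
  have h1 : ∀ G : Finset V, ¬Disjoint G F →
      insert none ((G \ F).image Option.some) =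
        G.image (fun v => if v ∈ F then none else some v) := by
    intro G hG
    obtain ⟨a, ha, hb⟩ := Finset.not_disjoint_iff.mp hG
    ext x
    simp only [Finset.mem_insert, Finset.mem_image, Finset.mem_sdiff]
    constructor
    · rintro (rfl | ⟨v, ⟨hv, hvF⟩, rfl⟩)
      · exact ⟨a, ha, by simp [hb]⟩
      · exact ⟨v, hv, by simp [hvF]⟩
    · rintro ⟨v, hv, rfl⟩
      by_cases h : v ∈ F
      · left; simp [h]
      · right; exact ⟨v, ⟨hv, h⟩, by simp [h]⟩
  have h2 : ∀ G : Finset V, Disjoint G F →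
      G.image Option.some = G.image (fun v => if v ∈ F then none else some v) := by
    intro G hG
    refine Finset.image_congr ?_
    intro v hv
    have : v ∉ F := Finset.disjoint_left.mp hG hv
    simp [this]
  ext G'
  constructor
  · rintro ⟨G, hG, ⟨hd, rfl⟩ | ⟨hd, rfl⟩⟩
    · exact ⟨G, hG, h1 G hd⟩
    · exact ⟨G, hG, h2 G hd⟩
  · rintro ⟨G, hG, rfl⟩
    by_cases hd : Disjoint G F
    · exact ⟨G, hG, Or.inr ⟨hd, (h2 G hd).symm⟩⟩
    · exact ⟨G, hG, Or.inl ⟨hd, (h1 G hd).symm⟩⟩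

theorem image_univ_sup {V W : Type*} [DecidableEq V] [DecidableEq W] {q : ℕ}
    (g : V → W) (f : Fin q → Finset V) :
    (Finset.univ.sup f).image g = Finset.univ.sup (fun i => (f i).image g) := by
  ext x
  simp only [Finset.mem_image, Finset.mem_sup, Finset.mem_univ, true_and]
  constructor
  · rintro ⟨a, ⟨i, hi⟩, rfl⟩
    exact ⟨i, a, hi, rfl⟩
  · rintro ⟨i, a, hi, rfl⟩
    exact ⟨a, ⟨i, hi⟩, rfl⟩

/-- `σ_q (Δ/F) = (σ_q Δ)/F` for every face `F` of `Δ`. -/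
theorem secant_faceContract {V : Type*} [Fintype V] [DecidableEq V]
    (Δ : Set (Finset V)) (hΔ : IsComplex Δ) (F : Finset V) (hF : F ∈ Δ)
    (q : ℕ) (hq : 1 ≤ q) :
    secant q (faceContract Δ F) = faceContract (secant q Δ) F := by
  rw [faceContract_eq_image, faceContract_eq_image]
  ext G'
  constructor
  · rintro ⟨f, hf, rfl⟩
    choose g hg hfg using hf
    refine ⟨Finset.univ.sup g, ⟨g, hg, rfl⟩, ?_⟩
    rw [image_univ_sup]
    congr 1
    funext i
    exact hfg i
  · rintro ⟨G, ⟨f, hf, rfl⟩, rfl⟩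
    exact ⟨_, fun i => ⟨f i, hf i, rfl⟩, image_univ_sup _ f⟩
end
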